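/- arXiv:math/0401365 — 8 statements merged into one kernel-verified Lean document; each statement's English description precedes it below -/
import Mathlib

section
/- Let (λ_n)_{n≥0} and (μ_n)_{n≥0} be nondecreasing sequences of real numbers tending to +∞ such that for every t > 0 the series ∑_{n=0}^∞ e^{−λ_n t} and ∑_{n=0}^∞ e^{−μ_n t} both converge. If ∑_{n=0}^∞ e^{−λ_n t} = ∑_{n=0}^∞ e^{−μ_n t} for all t > 0, then λ_n = μ_n for every n. -/
open Real Filter

/-- For nondecreasing exponents `a`, the series `∑ exp (-a n * t)` decays at least as fast as
`exp (-a 0 * t)` for `t ≥ 1`. -/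
theorem tsum_exp_neg_mul_le {a : ℕ → ℝ} (ha : Monotone a)
    (hsum : ∀ t : ℝ, 0 < t → Summable fun n => Real.exp (-(a n) * t)) {t : ℝ} (ht : 1 ≤ t) :
    ∑' n, Real.exp (-(a n) * t) ≤
      (∑' n, Real.exp (-(a n) * 1)) * Real.exp (-(a 0) * (t - 1)) := by
  rw [← tsum_mul_right]
  refine (hsum t (by linarith)).tsum_le_tsum (fun n => ?_) ((hsum 1 one_pos).mul_right _)
  rw [← Real.exp_add, Real.exp_le_exp]
  nlinarith [mul_le_mul_of_nonneg_right (ha n.zero_le) (sub_nonneg.2 ht)]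

/-- If the series with exponents `b` is dominated by the one with nondecreasing exponents `a`,
then the first exponents satisfy `a 0 ≤ b 0`. -/
theorem zero_le_zero_of_tsum_exp_le {a b : ℕ → ℝ} (ha : Monotone a)
    (hasum : ∀ t : ℝ, 0 < t → Summable fun n => Real.exp (-(a n) * t))
    (hbsum : ∀ t : ℝ, 0 < t → Summable fun n => Real.exp (-(b n) * t))
    (hle : ∀ t : ℝ, 0 < t →
      ∑' n, Real.exp (-(b n) * t) ≤ ∑' n, Real.exp (-(a n) * t)) :
    a 0 ≤ b 0 := by
  by_contra! hlt
  set C := ∑' n, Real.exp (-(a n) * 1)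
  have hd : 0 < a 0 - b 0 := sub_pos.2 hlt
  have hbound : ∀ t : ℝ, 1 ≤ t → Real.exp ((a 0 - b 0) * t) ≤ C * Real.exp (a 0) := by
    intro t ht
    have hpos : 0 < t := by linarith
    have h : Real.exp (-(b 0) * t) ≤ C * Real.exp (-(a 0) * (t - 1)) :=
      (((hbsum t hpos).le_tsum 0 fun _ _ => (Real.exp_pos _).le).trans (hle t hpos)).trans
        (tsum_exp_neg_mul_le ha hasum ht)
    calc Real.exp ((a 0 - b 0) * t)
        = Real.exp (-(b 0) * t) * Real.exp (a 0 * t) := by rw [← Real.exp_add]; ring_nf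
      _ ≤ C * Real.exp (-(a 0) * (t - 1)) * Real.exp (a 0 * t) := by gcongr
      _ = C * Real.exp (a 0) := by rw [mul_assoc, ← Real.exp_add]; ring_nf
  have htend : Tendsto (fun t : ℝ => Real.exp ((a 0 - b 0) * t)) atTop atTop :=
    Real.tendsto_exp_atTop.comp (tendsto_id.const_mul_atTop hd)
  obtain ⟨t, hgt, ht⟩ :=
    ((htend.eventually_gt_atTop (C * Real.exp (a 0))).and (eventually_ge_atTop 1)).exists
  exact (hbound t ht).not_gt hgt

/-- If two nondecreasing sequences of reals tending to `+∞`, whose associated Dirichlet-type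
series `∑ exp (-λ n * t)` converge for all `t > 0`, have equal sums for all `t > 0`, then the
sequences coincide. This is the analytic content of Propositions 4.1 and 4.2. -/
theorem trace_function_determines_spectrum
    (lam mu : ℕ → ℝ) (hlam_mono : Monotone lam) (hmu_mono : Monotone mu)
    (hlam_tend : Tendsto lam atTop atTop) (hmu_tend : Tendsto mu atTop atTop)
    (hlam_sum : ∀ t : ℝ, 0 < t → Summable fun n => Real.exp (-(lam n) * t))
    (hmu_sum : ∀ t : ℝ, 0 < t → Summable fun n => Real.exp (-(mu n) * t))
    (heq : ∀ t : ℝ, 0 < t →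
      (∑' n : ℕ, Real.exp (-(lam n) * t)) = ∑' n : ℕ, Real.exp (-(mu n) * t)) :
    ∀ n : ℕ, lam n = mu n := by
  intro n
  induction n using Nat.strong_induction_on with
  | _ n ih =>
    have hlam_shift : Monotone fun k => lam (k + n) := fun i j h => hlam_mono (by omega)
    have hmu_shift : Monotone fun k => mu (k + n) := fun i j h => hmu_mono (by omega)
    have hlam_tail : ∀ t : ℝ, 0 < t → Summable fun k => Real.exp (-(lam (k + n)) * t) :=
      fun t ht => (summable_nat_add_iff n).2 (hlam_sum t ht)
    have hmu_tail : ∀ t : ℝ, 0 < t → Summable fun k => Real.exp (-(mu (k + n)) * t) :=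
      fun t ht => (summable_nat_add_iff n).2 (hmu_sum t ht)
    have htail : ∀ t : ℝ, 0 < t →
        (∑' k, Real.exp (-(lam (k + n)) * t)) = ∑' k, Real.exp (-(mu (k + n)) * t) := by
      intro t ht
      have h := heq t ht
      rw [← (hlam_sum t ht).sum_add_tsum_nat_add n, ← (hmu_sum t ht).sum_add_tsum_nat_add n,
        Finset.sum_congr rfl fun k hk => by rw [ih k (Finset.mem_range.1 hk)]] at h
      exact add_left_cancel h
    have hle := zero_le_zero_of_tsum_exp_le hlam_shift hlam_tail hmu_tail
      fun t ht => (htail t ht).ge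
    have hge := zero_le_zero_of_tsum_exp_le hmu_shift hmu_tail hlam_tail
      fun t ht => (htail t ht).le
    simpa using le_antisymm hle hge
end

section
/- Let (λ_n)_{n≥0} be a nondecreasing sequence of real numbers tending to +∞ such that ∑_{n=0}^∞ e^{−λ_n t} converges for every t > 0. Suppose k is an index with λ_k < λ_{k+1}. Then lim_{t→+∞} e^{λ_{k+1} t} · ∑_{n=k+1}^∞ e^{−λ_n t} exists and equals the (finite) number of indices n with λ_n = λ_{k+1}; moreover, for every λ > λ_{k+1} the quotient (∑_{n=k+1}^∞ e^{−λ_n t})/e^{−λ t} tends to +∞ as t → +∞. -/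
open Real Filter

/-- If `a` is a lower bound of `u`, attained finitely often, then `exp (a * t)` times the exponential
series of `u` tends to the number of indices at which `a` is attained. -/
theorem tendsto_exp_mul_tsum_exp_neg {ι : Type*} {u : ι → ℝ} {a : ℝ} (hle : ∀ n, a ≤ u n)
    (hfin : {n | u n = a}.Finite) (hsum : Summable fun n => Real.exp (-u n)) :
    Tendsto (fun t : ℝ => Real.exp (a * t) * ∑' n, Real.exp (-u n * t)) atTop
      (nhds ({n | u n = a}.ncard : ℝ)) := by
  classical
  have hlim : ∑' n, (if u n = a then (1 : ℝ) else 0) = ({n | u n = a}.ncard : ℝ) := by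
    rw [tsum_eq_sum (s := hfin.toFinset) (fun n hn => if_neg (by simpa using hn)),
      Set.ncard_eq_toFinset_card _ hfin, Finset.card_eq_sum_ones, Nat.cast_sum]
    exact Finset.sum_congr rfl fun n hn => by simpa using hn
  rw [← hlim]
  simp_rw [← tsum_mul_left, ← Real.exp_add]
  refine tendsto_tsum_of_dominated_convergence (bound := fun n => Real.exp a * Real.exp (-u n))
    (hsum.mul_left _) (fun n => ?_) ?_
  · split_ifs with h
    · simp [h]
    · have hlt : a - u n < 0 := sub_neg.2 (lt_of_le_of_ne (hle n) (Ne.symm h))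
      refine (Real.tendsto_exp_atBot.comp (tendsto_id.const_mul_atTop_of_neg hlt)).congr fun t => ?_
      simp only [Function.comp_apply, id_eq]
      ring_nf
  · filter_upwards [eventually_ge_atTop (1 : ℝ)] with t ht n
    rw [Real.norm_eq_abs, Real.abs_exp, ← Real.exp_add, Real.exp_le_exp]
    nlinarith [hle n]

/-- Eigenvalue-recovery procedure from the proof of Proposition 4.2: if `lam` is nondecreasing,
tends to `+∞`, and `∑ exp (-lam n * t)` converges for all `t > 0`, and `lam k < lam (k+1)`,
then the set of indices `n` with `lam n = lam (k+1)` is finite,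
`exp (lam (k+1) * t) * (tail sum from index k+1)` tends to its cardinality as `t → +∞`,
and for `λ > lam (k+1)` the quotient of the tail sum by `exp (-λ t)` tends to `+∞`. -/
theorem eigenvalue_recovery
    (lam : ℕ → ℝ) (hmono : Monotone lam) (htend : Tendsto lam atTop atTop)
    (hsum : ∀ t : ℝ, 0 < t → Summable fun n => Real.exp (-(lam n) * t))
    (k : ℕ) (hk : lam k < lam (k + 1)) :
    {n : ℕ | lam n = lam (k + 1)}.Finite ∧
    Tendsto
      (fun t : ℝ => Real.exp (lam (k + 1) * t) * ∑' n : ℕ, Real.exp (-(lam (k + 1 + n)) * t))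
      atTop (nhds ((Nat.card {n : ℕ | lam n = lam (k + 1)} : ℝ))) ∧
    ∀ l : ℝ, lam (k + 1) < l →
      Tendsto
        (fun t : ℝ => (∑' n : ℕ, Real.exp (-(lam (k + 1 + n)) * t)) / Real.exp (-l * t))
        atTop atTop := by
  have hfin : {n : ℕ | lam n = lam (k + 1)}.Finite := by
    have h := htend.eventually (eventually_gt_atTop (lam (k + 1)))
    rw [← Nat.cofinite_eq_atTop] at h
    exact (eventually_cofinite.1 h).subset fun n hn => not_lt.2 (le_of_eq hn)
  have himage : (fun n => k + 1 + n) '' {n : ℕ | lam (k + 1 + n) = lam (k + 1)} =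
      {n : ℕ | lam n = lam (k + 1)} := by
    ext m
    refine ⟨?_, fun hm => ?_⟩
    · rintro ⟨n, hn, rfl⟩
      exact hn
    · have hkm : k < m := hmono.reflect_lt (hk.trans_eq (Eq.symm hm))
      obtain ⟨n, rfl⟩ := Nat.exists_eq_add_of_le (Nat.succ_le_of_lt hkm)
      exact ⟨n, hm, rfl⟩
  have hinj : Function.Injective fun n : ℕ => k + 1 + n := add_right_injective (k + 1)
  have hlim : Tendsto
      (fun t : ℝ => Real.exp (lam (k + 1) * t) * ∑' n : ℕ, Real.exp (-(lam (k + 1 + n)) * t))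
      atTop (nhds ((Nat.card {n : ℕ | lam n = lam (k + 1)} : ℝ))) := by
    rw [Nat.card_coe_set_eq, ← himage, Set.ncard_image_of_injective _ hinj]
    refine tendsto_exp_mul_tsum_exp_neg (fun n => hmono (Nat.le_add_right _ _))
      (hfin.preimage hinj.injOn) ?_
    simpa [Function.comp_def] using (hsum 1 one_pos).comp_injective hinj
  refine ⟨hfin, hlim, fun l hl => ?_⟩
  have hpos : (0 : ℝ) < Nat.card {n : ℕ | lam n = lam (k + 1)} := by
    rw [Nat.card_coe_set_eq, Nat.cast_pos, Set.ncard_pos hfin]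
    exact ⟨k + 1, rfl⟩
  have hexp : Tendsto (fun t : ℝ => Real.exp ((l - lam (k + 1)) * t)) atTop atTop :=
    Real.tendsto_exp_atTop.comp (tendsto_id.const_mul_atTop (sub_pos.2 hl))
  refine (hexp.atTop_mul_pos hpos hlim).congr fun t => ?_
  rw [← mul_assoc, ← Real.exp_add, div_eq_mul_inv, ← Real.exp_neg, mul_comm]
  congr 2
  ring
end

section
/- Let v₁, v₂ be linearly independent vectors in ℝ³ and let w ∈ ℝ³ be a nonzero vector orthogonal to both v₁ and v₂; set v₃ = (v₁ + v₂)/2 + w. Then for every t > 0, ∑_{(k,m,n)∈ℤ³} e^{−‖k v₁ + m v₂ + n v₃‖²/(4t)} = (∑_{j∈ℤ} e^{−j² ‖w‖²/t}) · (∑_{(k,m)∈ℤ²} e^{−‖k v₁ + m v₂‖²/(4t)}) + (∑_{j∈ℤ} e^{−(2j+1)² ‖w‖²/(4t)}) · (∑_{(k,m)∈ℤ²} e^{−‖k v₁ + m v₂ + (v₁+v₂)/2‖²/(4t)}). -/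
open Real RealInnerProductSpace

/-- Shifted Gaussian sums over `ℤ` converge. -/
theorem summable_exp_neg_mul_int_add_sq (a : ℝ) {c : ℝ} (hc : 0 < c) :
    Summable fun n : ℤ => Real.exp (-c * ((n : ℝ) + a) ^ 2) := by
  refine (HurwitzZeta.hasSum_int_evenKernel a (div_pos hc Real.pi_pos)).summable.congr fun n => ?_
  congr 1
  field_simp

/-- The squared norm of a combination of two linearly independent vectors dominates a multiple of
the sum of the squared coefficients. -/
theorem LinearIndependent.exists_pos_mul_sq_add_sq_le_norm_sq {E : Type*}
    [NormedAddCommGroup E] [NormedSpace ℝ E] {u v : E} (h : LinearIndependent ℝ ![u, v]) :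
    ∃ c : ℝ, 0 < c ∧ ∀ x y : ℝ, c * (x ^ 2 + y ^ 2) ≤ ‖x • u + y • v‖ ^ 2 := by
  obtain ⟨K, hK, hanti⟩ := (Fintype.linearCombination ℝ ![u, v]).exists_antilipschitzWith
    (LinearMap.ker_eq_bot.2 h.fintypeLinearCombination_injective)
  have hK' : (0 : ℝ) < K := hK
  refine ⟨1 / (2 * (K : ℝ) ^ 2), by positivity, fun x y => ?_⟩
  have hle := hanti.le_mul_norm (map_zero _) ![x, y]
  have hx := (norm_le_pi_norm ![x, y] 0).trans hle
  have hy := (norm_le_pi_norm ![x, y] 1).trans hle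
  simp only [Fintype.linearCombination_apply, Fin.sum_univ_two, Matrix.cons_val_zero,
    Matrix.cons_val_one, Real.norm_eq_abs] at hx hy
  have hx2 := sq_le_sq' (by linarith [abs_nonneg x]) hx
  have hy2 := sq_le_sq' (by linarith [abs_nonneg y]) hy
  rw [sq_abs, mul_pow] at hx2 hy2
  rw [div_mul_eq_mul_div, div_le_iff₀ (by positivity)]
  linarith

/-- Theta sums of shifted planar lattices converge. -/
theorem LinearIndependent.summable_exp_neg_norm_sq {E : Type*}
    [NormedAddCommGroup E] [NormedSpace ℝ E] {u v : E} (h : LinearIndependent ℝ ![u, v])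
    (a b : ℝ) {s : ℝ} (hs : 0 < s) :
    Summable fun p : ℤ × ℤ =>
      Real.exp (-‖((p.1 : ℝ) + a) • u + ((p.2 : ℝ) + b) • v‖ ^ 2 / s) := by
  obtain ⟨c, hc, hle⟩ := h.exists_pos_mul_sq_add_sq_le_norm_sq
  refine Summable.of_nonneg_of_le (fun _ => (Real.exp_pos _).le) (fun p => ?_)
    ((summable_exp_neg_mul_int_add_sq a (div_pos hc hs)).mul_of_nonneg
      (summable_exp_neg_mul_int_add_sq b (div_pos hc hs))
      (fun _ => (Real.exp_pos _).le) (fun _ => (Real.exp_pos _).le))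
  rw [← Real.exp_add, Real.exp_le_exp, div_le_iff₀ hs]
  have := hle (p.1 + a) (p.2 + b)
  field_simp
  linarith

/-- Split `ℤ³` by the parity of the last coordinate `n`, shifting the first two coordinates by
`⌊n / 2⌋`. -/
def intTripleParityEquiv : (ℤ × ℤ × ℤ) ⊕ (ℤ × ℤ × ℤ) ≃ ℤ × ℤ × ℤ where
  toFun := Sum.elim (fun q => (q.2.1 - q.1, q.2.2 - q.1, 2 * q.1))
    (fun q => (q.2.1 - q.1, q.2.2 - q.1, 2 * q.1 + 1))
  invFun p := if p.2.2 % 2 = 0 then .inl (p.2.2 / 2, p.1 + p.2.2 / 2, p.2.1 + p.2.2 / 2)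
    else .inr (p.2.2 / 2, p.1 + p.2.2 / 2, p.2.1 + p.2.2 / 2)
  left_inv := by
    rintro (⟨j, k, m⟩ | ⟨j, k, m⟩)
    · simp
    · have h : (2 * j + 1) / 2 = j := by omega
      simp [h]
  right_inv := by
    rintro ⟨k, m, n⟩
    dsimp only
    split_ifs with h <;> simp only [Sum.elim_inl, Sum.elim_inr, Prod.mk.injEq] <;> omega

theorem norm_add_smul_sq_of_inner_eq_zero {E : Type*} [NormedAddCommGroup E]
    [InnerProductSpace ℝ E] {x w : E} (h : ⟪x, w⟫ = 0) (r : ℝ) :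
    ‖x + r • w‖ ^ 2 = ‖x‖ ^ 2 + r ^ 2 * ‖w‖ ^ 2 := by
  rw [norm_add_sq_real, inner_smul_right, h, norm_smul, mul_pow, Real.norm_eq_abs, sq_abs]
  ring



/-- Decomposition `S₁ = S₁₁ + S₁₂` of the lattice theta sum for the manifold `N₂`
(proof of Lemma 4.3): for linearly independent `v₁, v₂` and a nonzero `w` orthogonal to
both, with `v₃ = (v₁ + v₂)/2 + w`, the theta sum of the lattice generated by `v₁, v₂, v₃`
splits according to the parity of the `v₃`-coefficient. -/
theorem theta_sum_split
    (v₁ v₂ w : EuclideanSpace ℝ (Fin 3))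
    (hindep : LinearIndependent ℝ ![v₁, v₂]) (hw : w ≠ 0)
    (hw1 : ⟪w, v₁⟫ = 0) (hw2 : ⟪w, v₂⟫ = 0)
    (v₃ : EuclideanSpace ℝ (Fin 3)) (hv₃ : v₃ = (1/2 : ℝ) • (v₁ + v₂) + w)
    (t : ℝ) (ht : 0 < t) :
    (∑' p : ℤ × ℤ × ℤ,
        Real.exp (-‖(p.1 : ℝ) • v₁ + (p.2.1 : ℝ) • v₂ + (p.2.2 : ℝ) • v₃‖ ^ 2 / (4 * t))) =
      (∑' j : ℤ, Real.exp (-((j : ℝ) ^ 2 * ‖w‖ ^ 2) / t)) *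
        (∑' p : ℤ × ℤ, Real.exp (-‖(p.1 : ℝ) • v₁ + (p.2 : ℝ) • v₂‖ ^ 2 / (4 * t))) +
      (∑' j : ℤ, Real.exp (-((2 * (j : ℝ) + 1) ^ 2 * ‖w‖ ^ 2) / (4 * t))) *
        (∑' p : ℤ × ℤ,
          Real.exp (-‖(p.1 : ℝ) • v₁ + (p.2 : ℝ) • v₂ + (1/2 : ℝ) • (v₁ + v₂)‖ ^ 2 / (4 * t))) := by
  have hwn : 0 < ‖w‖ ^ 2 := by have := norm_pos_iff.2 hw; positivity
  have h4t : 0 < 4 * t := by positivity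
  have hwE : Summable fun j : ℤ => Real.exp (-((j : ℝ) ^ 2 * ‖w‖ ^ 2) / t) := by
    refine (summable_exp_neg_mul_int_add_sq 0 (div_pos hwn ht)).congr fun j => ?_
    congr 1
    ring
  have hwO : Summable fun j : ℤ => Real.exp (-((2 * (j : ℝ) + 1) ^ 2 * ‖w‖ ^ 2) / (4 * t)) := by
    refine (summable_exp_neg_mul_int_add_sq (1 / 2) (div_pos hwn ht)).congr fun j => ?_
    congr 1
    field_simp
    ring
  have hvE : Summable fun p : ℤ × ℤ =>
      Real.exp (-‖(p.1 : ℝ) • v₁ + (p.2 : ℝ) • v₂‖ ^ 2 / (4 * t)) := by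
    simpa using hindep.summable_exp_neg_norm_sq 0 0 h4t
  have hvO : Summable fun p : ℤ × ℤ => Real.exp
      (-‖(p.1 : ℝ) • v₁ + (p.2 : ℝ) • v₂ + (1/2 : ℝ) • (v₁ + v₂)‖ ^ 2 / (4 * t)) := by
    refine (hindep.summable_exp_neg_norm_sq (1 / 2) (1 / 2) h4t).congr fun p => ?_
    congr 5
    module
  have hE := hwE.hasSum.mul hvE.hasSum (hwE.mul_of_nonneg hvE
    (fun _ => (Real.exp_pos _).le) (fun _ => (Real.exp_pos _).le))
  have hO := hwO.hasSum.mul hvO.hasSum (hwO.mul_of_nonneg hvO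
    (fun _ => (Real.exp_pos _).le) (fun _ => (Real.exp_pos _).le))
  have horth (x y : ℝ) : ⟪x • v₁ + y • v₂, w⟫ = 0 := by
    rw [real_inner_comm, inner_add_right, inner_smul_right, inner_smul_right, hw1, hw2]
    simp
  refine HasSum.tsum_eq (intTripleParityEquiv.hasSum_iff.1
    (HasSum.sum (hE.congr_fun fun q => ?_) (hO.congr_fun fun q => ?_)))
  · have hvec : ((q.2.1 - q.1 : ℤ) : ℝ) • v₁ + ((q.2.2 - q.1 : ℤ) : ℝ) • v₂ +
        ((2 * q.1 : ℤ) : ℝ) • v₃ =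
        ((q.2.1 : ℝ) • v₁ + (q.2.2 : ℝ) • v₂) + (2 * (q.1 : ℝ)) • w := by
      rw [hv₃]
      push_cast
      module
    simp only [Function.comp_apply, intTripleParityEquiv, Equiv.coe_fn_mk, Sum.elim_inl]
    rw [hvec, norm_add_smul_sq_of_inner_eq_zero (horth _ _), ← Real.exp_add]
    congr 1
    field_simp
    ring
  · have hvec : ((q.2.1 - q.1 : ℤ) : ℝ) • v₁ + ((q.2.2 - q.1 : ℤ) : ℝ) • v₂ +
        ((2 * q.1 + 1 : ℤ) : ℝ) • v₃ =
        ((q.2.1 : ℝ) • v₁ + (q.2.2 : ℝ) • v₂ + (1/2 : ℝ) • (v₁ + v₂)) +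
          (2 * (q.1 : ℝ) + 1) • w := by
      rw [hv₃]
      push_cast
      module
    have hshift : ⟪(q.2.1 : ℝ) • v₁ + (q.2.2 : ℝ) • v₂ + (1/2 : ℝ) • (v₁ + v₂), w⟫ = 0 := by
      rw [smul_add, inner_add_left, horth, horth, add_zero]
    simp only [Function.comp_apply, intTripleParityEquiv, Equiv.coe_fn_mk, Sum.elim_inr]
    rw [hvec, norm_add_smul_sq_of_inner_eq_zero hshift, ← Real.exp_add]
    congr 1
    field_simp
    ring
end

section
/- For every ℓ > 0 and every t > 0, the following identity holds: ((ℓ³/2)/(4πt)^{3/2}) ∑_{(m₁,m₂,m₃)∈ℤ³} e^{−(4m₁² + m₂² + m₃²)ℓ²/(4t)} + (2ℓ/(4√(πt))) ∑_{m∈ℤ} e^{−(m + 1/4)² (2ℓ)²/(4t)} + (2ℓ/(8√(πt))) ∑_{n∈ℤ} e^{−(n + 1/2)² (2ℓ)²/(4t)} = ((ℓ³/2)/(4πt)^{3/2}) ∑_{(m₁,m₂,m₃)∈ℤ³} e^{−(m₁² + 4m₂² + m₃²)ℓ²/(4t)} + (ℓ/(8√(πt))) ∑_{m∈ℤ} e^{−(m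 + 1/2)² ℓ²/(4t)} + (2ℓ/(8√(πt))) ∑_{n∈ℤ} e^{−(n + 1/2)² (2ℓ)²/(4t)} + (ℓ/(8√(πt))) ∑_{k∈ℤ} e^{−(k + 1/2)² ℓ²/(4t)}. -/
open Real

/-- A series over `ℤ` symmetric about `-1/2` is twice its sum over the even integers. -/
lemma tsum_int_eq_two_mul_tsum_even {f : ℤ → ℝ} (hf : ∀ k, f (-1 - k) = f k) :
    ∑' k, f k = 2 * ∑' k, f (2 * k) := by
  have hinj := mul_right_injective₀ (two_ne_zero : (2 : ℤ) ≠ 0)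
  by_cases h : Summable fun k => f (2 * k)
  · have hodd : HasSum (fun k => f (2 * k + 1)) (∑' k, f (2 * k)) := by
      have h' := ((Equiv.subLeft (-1 : ℤ)).hasSum_iff (f := fun k => f (2 * k))).mpr h.hasSum
      convert h' using 2 with k
      rw [← hf (2 * k + 1)]
      simp only [Function.comp_apply, Equiv.subLeft_apply]
      congr 1
      ring
    have hall := (hinj.hasSum_range_iff.mpr h.hasSum).add_isCompl
      (by simpa [Function.comp_def] using Int.isCompl_even_odd)
      (((add_left_injective 1).comp hinj).hasSum_range_iff.mpr hodd)
    rw [hall.tsum_eq, two_mul]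
  · have hnot : ¬ Summable f := fun hs => h (hs.comp_injective hinj)
    rw [tsum_eq_zero_of_not_summable h, tsum_eq_zero_of_not_summable hnot, mul_zero]

/-- Computational core of Theorem C: the trace function of `M₄` with parameters
`ℓ₁ = 2ℓ`, `‖ℓ₂‖ = ‖ℓ₃‖ = ℓ` equals the trace function of `M₆` with rectangular
covering-torus lattice generated by `(ℓ,0,0), (0,2ℓ,0), (0,0,ℓ)`, for all `t > 0`. -/
theorem M4_M6_trace_eq (l t : ℝ) (hl : 0 < l) (ht : 0 < t) :
    (l ^ 3 / 2) / (4 * π * t) ^ ((3:ℝ)/2) *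
        (∑' m : ℤ × ℤ × ℤ,
          Real.exp (-(4 * (m.1 : ℝ) ^ 2 + (m.2.1 : ℝ) ^ 2 + (m.2.2 : ℝ) ^ 2) * l ^ 2 / (4 * t))) +
      (2 * l) / (4 * Real.sqrt (π * t)) *
        (∑' m : ℤ, Real.exp (-((m : ℝ) + 1/4) ^ 2 * (2 * l) ^ 2 / (4 * t))) +
      (2 * l) / (8 * Real.sqrt (π * t)) *
        (∑' n : ℤ, Real.exp (-((n : ℝ) + 1/2) ^ 2 * (2 * l) ^ 2 / (4 * t))) =
    (l ^ 3 / 2) / (4 * π * t) ^ ((3:ℝ)/2) *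
        (∑' m : ℤ × ℤ × ℤ,
          Real.exp (-((m.1 : ℝ) ^ 2 + 4 * (m.2.1 : ℝ) ^ 2 + (m.2.2 : ℝ) ^ 2) * l ^ 2 / (4 * t))) +
      l / (8 * Real.sqrt (π * t)) *
        (∑' m : ℤ, Real.exp (-((m : ℝ) + 1/2) ^ 2 * l ^ 2 / (4 * t))) +
      (2 * l) / (8 * Real.sqrt (π * t)) *
        (∑' n : ℤ, Real.exp (-((n : ℝ) + 1/2) ^ 2 * (2 * l) ^ 2 / (4 * t))) +
      l / (8 * Real.sqrt (π * t)) *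
        (∑' k : ℤ, Real.exp (-((k : ℝ) + 1/2) ^ 2 * l ^ 2 / (4 * t))) := by
  have hquarter : ∑' m : ℤ, Real.exp (-((m : ℝ) + 1/2) ^ 2 * l ^ 2 / (4 * t)) =
      2 * ∑' m : ℤ, Real.exp (-((m : ℝ) + 1/4) ^ 2 * (2 * l) ^ 2 / (4 * t)) := by
    rw [tsum_int_eq_two_mul_tsum_even]
    · congr! 4 with m
      push_cast
      ring
    · intro k
      push_cast
      ring_nf
  have hswap : ∑' m : ℤ × ℤ × ℤ,
        Real.exp (-(4 * (m.1 : ℝ) ^ 2 + (m.2.1 : ℝ) ^ 2 + (m.2.2 : ℝ) ^ 2) * l ^ 2 / (4 * t)) =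
      ∑' m : ℤ × ℤ × ℤ,
        Real.exp (-((m.1 : ℝ) ^ 2 + 4 * (m.2.1 : ℝ) ^ 2 + (m.2.2 : ℝ) ^ 2) * l ^ 2 / (4 * t)) := by
    let e : ℤ × ℤ × ℤ ≃ ℤ × ℤ × ℤ :=
      { toFun := fun m => (m.2.1, m.1, m.2.2)
        invFun := fun m => (m.2.1, m.1, m.2.2)
        left_inv := fun _ => rfl
        right_inv := fun _ => rfl }
    rw [← e.tsum_eq]
    congr! 3 with m
    simp only [e, Equiv.coe_fn_mk]
    ring
  rw [hswap, hquarter]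
  ring
end

section
/- Let Λ be a full-rank lattice in ℝ³ and let λ₁ = min{‖v‖ : v ∈ Λ, v ≠ 0}. For λ > 0, consider the quotient Q(t) = (∑_{v∈Λ} e^{−‖v‖²/(4t)} − 1)/e^{−λ²/(4t)}. Then: if 0 < λ < λ₁, Q(t) → 0 as t → 0⁺; if λ = λ₁, Q(t) converges as t → 0⁺ to the (finite, positive) number of vectors v ∈ Λ with ‖v‖ = λ₁; and if λ > λ₁, Q(t) → +∞ as t → 0⁺. -/
open Real Filter

section GaussianLatticeSum

variable {E : Type*} [NormedAddCommGroup E] [NormedSpace ℝ E] [FiniteDimensional ℝ E]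
  (L : Submodule ℤ E) [DiscreteTopology L]

/-- The Gaussian `exp (-‖v‖² / s)` is summable over any discrete lattice. -/
lemma summable_exp_neg_norm_sq_div {s : ℝ} (hs : 0 < s) :
    Summable fun v : L ↦ Real.exp (-‖(v : E)‖ ^ 2 / s) := by
  set k := Module.finrank ℤ L + 1 with hk
  have hsum := ZLattice.summable_norm_pow_inv L (2 * k) (by omega)
  refine Summable.of_norm_bounded_eventually (hsum.mul_left (k.factorial * s ^ k)) ?_
  refine (Set.finite_singleton (0 : L)).subset fun v hv ↦ ?_
  by_contra h0
  refine hv ?_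
  have hv0 : 0 < ‖(v : E)‖ := by
    rw [norm_pos_iff]
    exact fun h ↦ h0 (by simpa using h)
  have h := Real.pow_div_factorial_le_exp (‖(v : E)‖ ^ 2 / s) (by positivity) k
  rw [Set.mem_ofPred_eq, Real.norm_eq_abs, Real.abs_exp, neg_div, Real.exp_neg]
  refine (inv_anti₀ (by positivity) h).trans (le_of_eq ?_)
  rw [div_pow, ← pow_mul, inv_pow]
  field_simp
  rfl

/-- A discrete lattice has finitely many vectors of any given length. -/
lemma finite_setOf_norm_eq (r : ℝ) : {v : L | ‖(v : E)‖ = r}.Finite := by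
  have h := (summable_exp_neg_norm_sq_div L one_pos).tendsto_cofinite_zero.eventually_lt_const
    (Real.exp_pos (-r ^ 2 / 1))
  refine Set.Finite.subset h fun v hv ↦ ?_
  have hv' : ‖(v : E)‖ = r := hv
  simp [hv']

open scoped Classical in
/-- Removing the contribution of the zero vector from the Gaussian sum and rescaling. -/
lemma tsum_exp_sub_one_div_exp (r : ℝ) {t : ℝ} (ht : 0 < t) :
    ((∑' v : L, Real.exp (-‖(v : E)‖ ^ 2 / (4 * t))) - 1) / Real.exp (-r ^ 2 / (4 * t)) =
      ∑' v : L, if v = 0 then 0 else Real.exp ((r ^ 2 - ‖(v : E)‖ ^ 2) / (4 * t)) := by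
  rw [(summable_exp_neg_norm_sq_div L (by positivity : 0 < 4 * t)).tsum_eq_add_tsum_ite 0]
  simp only [ZeroMemClass.coe_zero, norm_zero, ne_eq, OfNat.ofNat_ne_zero, not_false_eq_true,
    zero_pow, neg_zero, zero_div, Real.exp_zero, add_sub_cancel_left]
  rw [← tsum_div_const]
  congr! 2 with v
  split_ifs
  · simp
  · rw [← Real.exp_sub]
    congr 1
    ring

/-- If no nonzero vector is shorter than `r > 0`, then the Gaussian sum without its constant term,
normalized by `exp (-r² / (4t))`, tends to the number of vectors of length `r`. -/
lemma tendsto_tsum_exp_sub_one_div_exp {r : ℝ} (hr : 0 < r)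
    (hmin : ∀ v : L, v ≠ 0 → r ≤ ‖(v : E)‖) :
    Tendsto (fun t : ℝ ↦ ((∑' v : L, Real.exp (-‖(v : E)‖ ^ 2 / (4 * t))) - 1) /
      Real.exp (-r ^ 2 / (4 * t))) (nhdsWithin 0 (Set.Ioi 0))
      (nhds (Nat.card {v : L // ‖(v : E)‖ = r} : ℝ)) := by
  classical
  have hcard : (Nat.card {v : L // ‖(v : E)‖ = r} : ℝ) =
      ∑' v : L, if ‖(v : E)‖ = r then 1 else 0 := by
    have hfin := finite_setOf_norm_eq L r
    rw [tsum_eq_sum (s := hfin.toFinset) (by simp)]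
    rw [Finset.sum_congr rfl fun v hv ↦ if_pos (by simpa using hv)]
    rw [Finset.sum_const, nsmul_one]
    exact congrArg _ ((Nat.card_coe_set_eq {v : L | ‖(v : E)‖ = r}).trans
      (Set.ncard_eq_toFinset_card _ hfin))
  rw [hcard]
  refine Tendsto.congr' (f₁ := fun t : ℝ ↦ ∑' v : L,
    if v = 0 then 0 else Real.exp ((r ^ 2 - ‖(v : E)‖ ^ 2) / (4 * t))) ?_ ?_
  · filter_upwards [self_mem_nhdsWithin] with t ht
    exact (tsum_exp_sub_one_div_exp L r ht).symm
  refine tendsto_tsum_of_dominated_convergence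
    (bound := fun v : L ↦ Real.exp (r ^ 2 / 4) * Real.exp (-‖(v : E)‖ ^ 2 / 4))
    ((summable_exp_neg_norm_sq_div L four_pos).mul_left _) (fun v ↦ ?_) ?_
  · rcases eq_or_ne v 0 with rfl | hv
    · simp [hr.ne]
    · simp only [hv, if_false]
      rcases (hmin v hv).eq_or_lt with h | h
      · simp [← h]
      · rw [if_neg h.ne']
        have hneg : (r ^ 2 - ‖(v : E)‖ ^ 2) / 4 < 0 := by nlinarith
        refine Real.tendsto_exp_atBot.comp ?_
        refine (tendsto_inv_nhdsGT_zero.const_mul_atTop_of_neg hneg).congr fun t ↦ ?_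
        rw [← div_eq_mul_inv, div_div]
  · filter_upwards [Ioo_mem_nhdsGT one_pos] with t ht v
    split_ifs with hv
    · simpa using by positivity
    · rw [Real.norm_eq_abs, Real.abs_exp, ← Real.exp_add, Real.exp_le_exp,
        div_le_iff₀ (by linarith [ht.1])]
      have hle : r ^ 2 ≤ ‖(v : E)‖ ^ 2 := by
        gcongr
        exact hmin v hv
      nlinarith [ht.2]

end GaussianLatticeSum

/-- Length-recovery procedure of Lemma 4.3: for a full-rank lattice `Λ ⊂ ℝ³` with minimal
nonzero length `λ₁`, the quotient `Q(t) = (∑_{v∈Λ} e^{-‖v‖²/(4t)} − 1)/e^{-λ²/(4t)}` tends,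
as `t → 0⁺`, to `0` if `λ < λ₁`, to the (finite, positive) number of vectors of length `λ₁`
if `λ = λ₁`, and to `+∞` if `λ > λ₁`. -/
theorem lattice_length_recovery
    (Λ : Submodule ℤ (EuclideanSpace ℝ (Fin 3))) [DiscreteTopology Λ] [IsZLattice ℝ Λ]
    (lam₁ : ℝ)
    (hlam₁ : IsLeast {r : ℝ | ∃ v ∈ Λ, v ≠ 0 ∧ ‖v‖ = r} lam₁)
    (Q : ℝ → ℝ → ℝ)
    (hQ : ∀ lam t : ℝ, Q lam t =
      ((∑' v : Λ, Real.exp (-‖(v : EuclideanSpace ℝ (Fin 3))‖ ^ 2 / (4 * t))) - 1) /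
        Real.exp (-lam ^ 2 / (4 * t)))
    (lam : ℝ) (hlam : 0 < lam) :
    (lam < lam₁ → Tendsto (Q lam) (nhdsWithin 0 (Set.Ioi 0)) (nhds 0)) ∧
    (lam = lam₁ →
      {v : Λ | ‖(v : EuclideanSpace ℝ (Fin 3))‖ = lam₁}.Finite ∧
      0 < Nat.card {v : Λ // ‖(v : EuclideanSpace ℝ (Fin 3))‖ = lam₁} ∧
      Tendsto (Q lam) (nhdsWithin 0 (Set.Ioi 0))
        (nhds ((Nat.card {v : Λ // ‖(v : EuclideanSpace ℝ (Fin 3))‖ = lam₁} : ℝ)))) ∧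
    (lam₁ < lam → Tendsto (Q lam) (nhdsWithin 0 (Set.Ioi 0)) atTop) := by
  obtain ⟨⟨v₀, hv₀, hv₀_ne, hv₀_norm⟩, hmin⟩ := hlam₁
  have hlam₁_pos : 0 < lam₁ := hv₀_norm ▸ norm_pos_iff.mpr hv₀_ne
  have hmin' : ∀ v : Λ, v ≠ 0 → lam₁ ≤ ‖(v : EuclideanSpace ℝ (Fin 3))‖ := fun v hv ↦
    hmin ⟨v, v.2, by simpa using hv, rfl⟩
  have hfin := finite_setOf_norm_eq Λ lam₁
  have hcard : 0 < Nat.card {v : Λ // ‖(v : EuclideanSpace ℝ (Fin 3))‖ = lam₁} := by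
    have : Finite {v : Λ // ‖(v : EuclideanSpace ℝ (Fin 3))‖ = lam₁} := hfin.to_subtype
    have : Nonempty {v : Λ // ‖(v : EuclideanSpace ℝ (Fin 3))‖ = lam₁} := ⟨⟨⟨v₀, hv₀⟩, hv₀_norm⟩⟩
    exact Nat.card_pos
  have hlim : Tendsto (Q lam₁) (nhdsWithin 0 (Set.Ioi 0))
      (nhds (Nat.card {v : Λ // ‖(v : EuclideanSpace ℝ (Fin 3))‖ = lam₁} : ℝ)) :=
    (tendsto_tsum_exp_sub_one_div_exp Λ hlam₁_pos hmin').congr fun t ↦ (hQ lam₁ t).symm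
  have hscale : ∀ t, Q lam₁ t * Real.exp ((lam ^ 2 - lam₁ ^ 2) / 4 * t⁻¹) = Q lam t := by
    intro t
    rw [hQ, hQ, div_mul_eq_mul_div, mul_div_assoc, ← Real.exp_sub, div_eq_mul_inv _ (Real.exp _),
      ← Real.exp_neg]
    congr 2
    rw [← div_eq_mul_inv, div_div]
    ring
  refine ⟨fun h ↦ ?_, fun h ↦ ⟨hfin, hcard, h ▸ hlim⟩, fun h ↦ ?_⟩
  · have hneg : (lam ^ 2 - lam₁ ^ 2) / 4 < 0 := by nlinarith
    simpa using (hlim.mul (Real.tendsto_exp_atBot.comp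
      (tendsto_inv_nhdsGT_zero.const_mul_atTop_of_neg hneg))).congr hscale
  · have hpos : 0 < (lam ^ 2 - lam₁ ^ 2) / 4 := by nlinarith
    exact (hlim.pos_mul_atTop (by exact_mod_cast hcard) (Real.tendsto_exp_atTop.comp
      (tendsto_inv_nhdsGT_zero.const_mul_atTop hpos))).congr hscale
end

section
/- For ℓ₁ > 0 and a full-rank lattice L in ℝ², set Λ(ℓ₁, L) = {(ℓ₁ n, u) : n ∈ ℤ, u ∈ L} ⊂ ℝ³ and define, for t > 0, F_{ℓ₁,L}(t) = ((ℓ₁/2)·covol(L)/(4πt)^{3/2}) ∑_{v∈Λ(ℓ₁,L)} e^{−‖v‖²/(4t)} + (ℓ₁/(4√(πt))) ∑_{m∈ℤ} e^{−(m + 1/2)² ℓ₁²/(4t)}. If ℓ₁, ℓ₁' > 0 and L, L' are full-rank lattices in ℝ² with F_{ℓ₁,L}(t) = F_{ℓ₁',L'}(t) for all t > 0, then ℓ₁ = ℓ₁' and there exists a linear isometry O of ℝ² with O(L) = L'. -/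
open Real

/-- The trace function `tr(H_{M₂})` of the flat 3-manifold `M₂` determined by the orthogonal
parameter `ℓ₁ > 0` and the plane lattice `L`, with `vol(M₂) = (ℓ₁/2)·covol(L)` and covering
torus lattice `Λ(ℓ₁, L) = {(ℓ₁ n, u) : n ∈ ℤ, u ∈ L}` (Theorem A). -/
noncomputable def M2trace (l₁ : ℝ) (L : Submodule ℤ (EuclideanSpace ℝ (Fin 2))) (t : ℝ) : ℝ :=
  (l₁ / 2 * ZLattice.covolume L) / (4 * π * t) ^ ((3:ℝ)/2) *
    (∑' v : {v : EuclideanSpace ℝ (Fin 3) | ∃ n : ℤ, ∃ u ∈ L,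
        v = (WithLp.equiv 2 (Fin 3 → ℝ)).symm ![l₁ * n, u 0, u 1]},
      Real.exp (-‖(v : EuclideanSpace ℝ (Fin 3))‖ ^ 2 / (4 * t))) +
  l₁ / (4 * Real.sqrt (π * t)) *
    (∑' m : ℤ, Real.exp (-((m : ℝ) + 1/2) ^ 2 * l₁ ^ 2 / (4 * t)))

section ExponentialSums

open Filter Topology

variable {I J : Type*} {r : I → ℝ} {q : J → ℝ}

lemma finite_le_of_summable_exp_neg (h : Summable fun i => exp (-r i)) (R : ℝ) :
    {i | r i ≤ R}.Finite := by
  have h1 := h.tendsto_cofinite_zero.eventually_lt_const (exp_pos (-R))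
  refine (Filter.eventually_cofinite.1 h1).subset fun i hi => ?_
  simpa using hi

lemma exists_min_of_summable_exp_neg (h : Summable fun i => exp (-r i)) {S : Set I}
    (hS : S.Nonempty) : ∃ i ∈ S, ∀ j ∈ S, r i ≤ r j := by
  obtain ⟨i₀, hi₀⟩ := hS
  have hfin : (S ∩ {i | r i ≤ r i₀}).Finite :=
    (finite_le_of_summable_exp_neg h _).subset Set.inter_subset_right
  obtain ⟨i, hi, hmin⟩ := Set.exists_min_image _ r hfin ⟨i₀, hi₀, le_refl (r i₀)⟩
  refine ⟨i, hi.1, fun j hj => ?_⟩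
  by_cases hj' : r j ≤ r i₀
  · exact hmin j ⟨hj, hj'⟩
  · exact hi.2.trans (not_le.1 hj').le

lemma exp_neg_mul_le {m x s : ℝ} (hm : m ≤ x) (hs : 1 ≤ s) :
    exp (-(s * x)) ≤ exp m * exp (-(s * m)) * exp (-x) := by
  rw [← exp_add, ← exp_add, exp_le_exp]
  nlinarith

lemma summable_exp_neg_mul (h : Summable fun i => exp (-r i)) {m : ℝ} (hm : ∀ i, m ≤ r i)
    {s : ℝ} (hs : 1 ≤ s) : Summable fun i => exp (-(s * r i)) :=
  (h.mul_left (exp m * exp (-(s * m)))).of_nonneg_of_le (fun _ => (exp_pos _).le)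
    fun i => exp_neg_mul_le (hm i) hs

lemma tsum_exp_neg_mul_le_s12 (h : Summable fun i => exp (-r i)) {m : ℝ} (hm : ∀ i, m ≤ r i)
    {s : ℝ} (hs : 1 ≤ s) :
    ∑' i, exp (-(s * r i)) ≤ exp m * (∑' i, exp (-r i)) * exp (-(s * m)) := by
  calc _ ≤ ∑' i, exp m * exp (-(s * m)) * exp (-r i) :=
        (summable_exp_neg_mul h hm hs).tsum_le_tsum (fun i => exp_neg_mul_le (hm i) hs)
          (h.mul_left _)
    _ = _ := by rw [tsum_mul_left]; ring

lemma le_of_tsum_exp_neg_mul_le (hr : Summable fun i => exp (-r i)) (hr0 : ∀ i, 0 ≤ r i)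
    (hq : Summable fun j => exp (-q j)) {m : ℝ} (hm : ∀ j, m ≤ q j) (i : I)
    (hle : ∀ s, 1 ≤ s → ∑' i, exp (-(s * r i)) ≤ ∑' j, exp (-(s * q j))) : m ≤ r i := by
  by_contra! hlt
  have hT : Tendsto (fun s : ℝ => exp (s * (m - r i))) atTop atTop :=
    tendsto_exp_atTop.comp (tendsto_id.atTop_mul_const (sub_pos.2 hlt))
  obtain ⟨s, hs1, hs⟩ := ((eventually_ge_atTop (1 : ℝ)).and
    (hT.eventually_gt_atTop (exp m * (∑' j, exp (-q j))))).exists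
  have h1 : exp (-(s * r i)) ≤ ∑' i, exp (-(s * r i)) :=
    (summable_exp_neg_mul hr hr0 hs1).le_tsum i fun _ _ => (exp_pos _).le
  have h2 := (h1.trans (hle s hs1)).trans (tsum_exp_neg_mul_le_s12 hq hm hs1)
  have h3 : exp (s * (m - r i)) * exp (-(s * m)) = exp (-(s * r i)) := by
    rw [← exp_add]; ring_nf
  rw [← h3] at h2
  exact hs.not_ge (le_of_mul_le_mul_right h2 (exp_pos _))

lemma tendsto_exp_mul_tsum_exp_neg_mul (hq : Summable fun j => exp (-q j)) {m R : ℝ}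
    (hm : ∀ j, m ≤ q j) (hR : R < m) :
    Tendsto (fun s => exp (s * R) * ∑' j, exp (-(s * q j))) atTop (𝓝 0) := by
  have hT : Tendsto (fun s : ℝ => exp m * (∑' j, exp (-q j)) * exp (-(s * (m - R)))) atTop
      (𝓝 0) := by
    simpa using (tendsto_exp_neg_atTop_nhds_zero.comp
      (tendsto_id.atTop_mul_const (sub_pos.2 hR))).const_mul (exp m * (∑' j, exp (-q j)))
  refine squeeze_zero' (.of_forall fun s => by positivity) ?_ hT
  filter_upwards [eventually_ge_atTop 1] with s hs
  calc _ ≤ exp (s * R) * (exp m * (∑' j, exp (-q j)) * exp (-(s * m))) := by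
        gcongr; exact tsum_exp_neg_mul_le_s12 hq hm hs
    _ = exp m * (∑' j, exp (-q j)) * (exp (s * R) * exp (-(s * m))) := by ring
    _ = _ := by rw [← exp_add]; ring_nf

lemma eq_zero_of_tendsto_sum_mul_exp (X : Finset ℝ) (c : ℝ → ℝ) (hX : ∀ x ∈ X, 0 ≤ x)
    (h : Tendsto (fun s => ∑ x ∈ X, c x * exp (s * x)) atTop (𝓝 0)) : ∀ x ∈ X, c x = 0 := by
  induction X using Finset.induction_on_max with
  | empty => simp
  | insert a X ha ih =>
    have hnot : a ∉ X := fun h => (ha a h).false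
    have ha0 : 0 ≤ a := hX a (Finset.mem_insert_self a X)
    have h1 : Tendsto (fun s => exp (-(s * a)) * ∑ x ∈ insert a X, c x * exp (s * x)) atTop
        (𝓝 0) := by
      refine squeeze_zero_norm' ?_ (tendsto_zero_iff_norm_tendsto_zero.1 h)
      filter_upwards [eventually_ge_atTop 0] with s hs
      rw [norm_mul, Real.norm_eq_abs, abs_exp]
      exact mul_le_of_le_one_left (norm_nonneg _)
        (exp_le_one_iff.2 (neg_nonpos.2 (mul_nonneg hs ha0)))
    have h2 : Tendsto (fun s => exp (-(s * a)) * ∑ x ∈ insert a X, c x * exp (s * x)) atTop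
        (𝓝 (c a + ∑ x ∈ X, c x * 0)) := by
      have h3 : ∀ x ∈ X, Tendsto (fun s : ℝ => c x * exp (-(s * (a - x)))) atTop
          (𝓝 (c x * 0)) := fun x hx =>
        (tendsto_exp_neg_atTop_nhds_zero.comp
          (tendsto_id.atTop_mul_const (sub_pos.2 (ha x hx)))).const_mul (c x)
      refine ((tendsto_finsetSum X h3).const_add (c a)).congr fun s => ?_
      rw [Finset.sum_insert hnot, mul_add, Finset.mul_sum]
      congr 1
      · rw [mul_left_comm, ← exp_add]; simp
      · refine Finset.sum_congr rfl fun x _ => ?_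
        rw [mul_left_comm, ← exp_add]; ring_nf
    have hca : c a = 0 := by simpa using tendsto_nhds_unique h2 h1
    simp only [Finset.sum_insert hnot, hca, zero_mul, zero_add] at h
    intro x hx
    rcases Finset.mem_insert.1 hx with rfl | hx
    · exact hca
    · exact ih (fun y hy => hX y (Finset.mem_insert_of_mem hy)) h x hx

lemma tendsto_mul_exp_mul_tsum (h : Summable fun i => exp (-r i)) (hr0 : ∀ i, 0 ≤ r i)
    {a : I → ℝ} (ha : ∀ i, |a i| ≤ 1) (R : ℝ)
    (hlim : Tendsto (fun s => exp (s * R) * ∑' i, a i * exp (-(s * r i))) atTop (𝓝 0)) :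
    Tendsto (fun s => s * (exp (s * R) * ∑' i, a i * exp (-(s * r i)))) atTop (𝓝 0) := by
  classical
  set K := (finite_le_of_summable_exp_neg h R).toFinset with hK
  have hKmem : ∀ i, i ∉ K ↔ R < r i := by simp [hK]
  obtain ⟨m, hRm, hm⟩ : ∃ m, R < m ∧ ∀ i : {i // i ∉ K}, m ≤ r i := by
    by_cases hne : {i | i ∉ K}.Nonempty
    · obtain ⟨i, hi, hmin⟩ := exists_min_of_summable_exp_neg h hne
      exact ⟨r i, (hKmem i).1 hi, fun j => hmin j j.2⟩
    · exact ⟨R + 1, by linarith, fun i => (hne ⟨i, i.2⟩).elim⟩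
  have hsub : Summable fun i : {i // i ∉ K} => exp (-r i) := h.subtype _
  obtain ⟨n, hRn, hnm⟩ := exists_between hRm
  set tail : ℝ → ℝ := fun s => ∑' i : {i // i ∉ K}, a i * exp (-(s * r i)) with htail
  have hsum : ∀ s, 1 ≤ s → Summable fun i => a i * exp (-(s * r i)) := fun s hs =>
    (summable_exp_neg_mul h hr0 hs).of_norm_bounded fun i => by
      rw [norm_mul, Real.norm_eq_abs, Real.norm_eq_abs, abs_exp]
      exact mul_le_of_le_one_left (exp_pos _).le (ha i)
  have htb : ∀ s, 1 ≤ s → |tail s| ≤ ∑' i : {i // i ∉ K}, exp (-(s * r i)) := fun s hs => by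
    rw [← Real.norm_eq_abs]
    refine tsum_of_norm_bounded (summable_exp_neg_mul hsub hm hs).hasSum fun i => ?_
    rw [norm_mul, Real.norm_eq_abs, Real.norm_eq_abs, abs_exp]
    exact mul_le_of_le_one_left (exp_pos _).le (ha i)
  have ht1 : Tendsto (fun s => exp (s * n) * tail s) atTop (𝓝 0) := by
    refine squeeze_zero_norm' ?_ (tendsto_exp_mul_tsum_exp_neg_mul hsub hm hnm)
    filter_upwards [eventually_ge_atTop 1] with s hs
    rw [norm_mul, Real.norm_eq_abs, Real.norm_eq_abs, abs_exp]
    gcongr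
    exact htb s hs
  have hexp : Tendsto (fun s : ℝ => exp (-(s * (n - R)))) atTop (𝓝 0) :=
    tendsto_exp_neg_atTop_nhds_zero.comp (tendsto_id.atTop_mul_const (sub_pos.2 hRn))
  have hsexp : Tendsto (fun s : ℝ => s * exp (-(s * (n - R)))) atTop (𝓝 0) := by
    refine (tendsto_rpow_mul_exp_neg_mul_atTop_nhds_zero 1 (n - R) (sub_pos.2 hRn)).congr
      fun s => ?_
    rw [rpow_one]; ring_nf
  have ht2 : Tendsto (fun s => exp (s * R) * tail s) atTop (𝓝 0) := by
    have := hexp.mul ht1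
    rw [mul_zero] at this
    refine this.congr fun s => ?_
    rw [← mul_assoc, ← exp_add]; ring_nf
  have ht3 : Tendsto (fun s => s * (exp (s * R) * tail s)) atTop (𝓝 0) := by
    have := hsexp.mul ht1
    rw [mul_zero] at this
    refine this.congr fun s => ?_
    rw [mul_assoc, ← mul_assoc (exp _), ← exp_add]; ring_nf
  set c : ℝ → ℝ := fun x => ∑ i ∈ K with R - r i = x, a i with hc
  have hsplit : ∀ s, 1 ≤ s → exp (s * R) * ∑' i, a i * exp (-(s * r i)) =
      (∑ x ∈ K.image (fun i => R - r i), c x * exp (s * x)) + exp (s * R) * tail s := by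
    intro s hs
    rw [← (hsum s hs).sum_add_tsum_subtype_compl K, mul_add]
    congr 1
    rw [Finset.mul_sum, ← Finset.sum_fiberwise_of_maps_to
      (fun i hi => Finset.mem_image_of_mem (fun i => R - r i) hi)]
    refine Finset.sum_congr rfl fun x _ => ?_
    rw [hc, Finset.sum_mul]
    refine Finset.sum_congr rfl fun i hi => ?_
    rw [← (Finset.mem_filter.1 hi).2, mul_left_comm, ← exp_add]
    ring_nf
  have hfin : Tendsto (fun s => ∑ x ∈ K.image (fun i => R - r i), c x * exp (s * x)) atTop
      (𝓝 0) := by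
    have := hlim.sub ht2
    rw [sub_zero] at this
    refine this.congr' ?_
    filter_upwards [eventually_ge_atTop 1] with s hs
    rw [hsplit s hs, add_sub_cancel_right]
  have hzero := eq_zero_of_tendsto_sum_mul_exp _ c (by simp [hK]) hfin
  refine ht3.congr' ?_
  filter_upwards [eventually_ge_atTop 1] with s hs
  rw [hsplit s hs, Finset.sum_eq_zero fun x hx => by rw [hzero x hx, zero_mul], zero_add]

lemma tendsto_mul_exp_mul_tsum_sub (hr : Summable fun i => exp (-r i)) (hr0 : ∀ i, 0 ≤ r i)
    (hq : Summable fun j => exp (-q j)) (hq0 : ∀ j, 0 ≤ q j) (R : ℝ)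
    (hlim : Tendsto (fun s => exp (s * R) *
      (∑' i, exp (-(s * r i)) - ∑' j, exp (-(s * q j)))) atTop (𝓝 0)) :
    Tendsto (fun s => s * (exp (s * R) *
      (∑' i, exp (-(s * r i)) - ∑' j, exp (-(s * q j))))) atTop (𝓝 0) := by
  set a : I ⊕ J → ℝ := Sum.elim (fun _ => 1) (fun _ => -1)
  have hsum : Summable fun k => exp (-(Sum.elim r q k)) := (hr.hasSum.sum hq.hasSum).summable
  have heq : ∀ s, 1 ≤ s → ∑' i, exp (-(s * r i)) - ∑' j, exp (-(s * q j)) =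
      ∑' k, a k * exp (-(s * Sum.elim r q k)) := fun s hs => by
    have h1 := summable_exp_neg_mul hr hr0 hs
    have h2 := summable_exp_neg_mul hq hq0 hs
    rw [sub_eq_add_neg, ← tsum_neg]
    refine (HasSum.tsum_eq (HasSum.sum ?_ ?_)).symm
    · simpa [a, Function.comp_def] using h1.hasSum
    · simpa [a, Function.comp_def] using h2.neg.hasSum
  have hlim' := hlim.congr' (f₂ := fun s => exp (s * R) *
      ∑' k, a k * exp (-(s * Sum.elim r q k))) (by
    filter_upwards [eventually_ge_atTop 1] with s hs
    rw [heq s hs])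
  refine (tendsto_mul_exp_mul_tsum hsum (by rintro (i | j) <;> simp [hr0, hq0])
    (by rintro (i | j) <;> simp [a]) R hlim').congr' ?_
  filter_upwards [eventually_ge_atTop 1] with s hs
  rw [heq s hs]

lemma tendsto_tsum_exp_neg_mul_one (hr : Summable fun i => exp (-r i)) (i₀ : I) (hi₀ : r i₀ = 0)
    (hpos : ∀ i, i ≠ i₀ → 0 < r i) :
    Tendsto (fun s => ∑' i, exp (-(s * r i))) atTop (𝓝 1) := by
  have hr0 : ∀ i, 0 ≤ r i := fun i => by
    by_cases hi : i = i₀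
    · rw [hi, hi₀]
    · exact (hpos i hi).le
  have hsub : Summable fun i : (({i₀} : Set I)ᶜ : Set I) => exp (-r i) := hr.subtype _
  obtain ⟨m, hm0, hm⟩ : ∃ m, 0 < m ∧ ∀ i : (({i₀} : Set I)ᶜ : Set I), m ≤ r i := by
    by_cases hne : (({i₀} : Set I)ᶜ).Nonempty
    · obtain ⟨i, hi, hmin⟩ := exists_min_of_summable_exp_neg hr hne
      exact ⟨r i, hpos i hi, fun j => hmin j j.2⟩
    · exact ⟨1, one_pos, fun i => (hne ⟨i, i.2⟩).elim⟩
  have h := (tendsto_exp_mul_tsum_exp_neg_mul hsub hm hm0).const_add 1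
  rw [add_zero] at h
  refine h.congr' ?_
  filter_upwards [eventually_ge_atTop 1] with s hs
  rw [← (summable_exp_neg_mul hr hr0 hs).tsum_subtype_add_tsum_subtype_compl {i₀},
    tsum_singleton i₀ (fun i => exp (-(s * r i))), hi₀]
  simp

lemma le_of_tsum_exp_neg_mul_eq {K : Type*} {g : K → I} {g' : K → J}
    (hr : Summable fun i => exp (-r i)) (hr0 : ∀ i, 0 ≤ r i)
    (hq : Summable fun j => exp (-q j)) (hq0 : ∀ j, 0 ≤ q j)
    (hg : g.Injective) (hg' : g'.Injective) (hgg' : ∀ k, r (g k) = q (g' k))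
    (heq : ∀ s, 1 ≤ s → ∑' i, exp (-(s * r i)) = ∑' j, exp (-(s * q j)))
    {i : I} (hi : i ∉ Set.range g) {m : ℝ} (hm : ∀ j, j ∉ Set.range g' → m ≤ q j) :
    m ≤ r i := by
  refine le_of_tsum_exp_neg_mul_le (I := ((Set.range g)ᶜ : Set I))
    (J := ((Set.range g')ᶜ : Set J)) (r := fun i => r i) (q := fun j => q j)
    (hr.subtype _) (fun i => hr0 i) (hq.subtype _) (fun j => hm j j.2) ⟨i, hi⟩ fun s hs => ?_
  have h := heq s hs
  rw [← (summable_exp_neg_mul hr hr0 hs).tsum_subtype_add_tsum_subtype_compl (Set.range g),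
    ← (summable_exp_neg_mul hq hq0 hs).tsum_subtype_add_tsum_subtype_compl (Set.range g'),
    tsum_range (fun i => exp (-(s * r i))) hg, tsum_range (fun j => exp (-(s * q j))) hg'] at h
  simp only [hgg'] at h
  exact (add_left_cancel h).le

end ExponentialSums

section PlaneLattices

local notation "E" => EuclideanSpace ℝ (Fin 2)

lemma summable_exp_neg_norm_sq (L : Submodule ℤ E) [DiscreteTopology L] [IsZLattice ℝ L] :
    Summable fun u : L => exp (-‖(u : E)‖ ^ 2) := by
  have hrank : Module.finrank ℤ L < 4 := by
    rw [ZLattice.rank ℝ L]; simp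
  refine ((ZLattice.summable_norm_pow_inv L 4 hrank).mul_left 2).of_norm_bounded_eventually ?_
  filter_upwards [(Set.finite_singleton (0 : L)).compl_mem_cofinite] with u hu
  have hu0 : 0 < ‖(u : E)‖ := by simpa using hu
  rw [Real.norm_eq_abs, abs_exp, exp_neg, inv_pow, ← div_eq_mul_inv,
    inv_le_comm₀ (exp_pos _) (by positivity), inv_div]
  have h := quadratic_le_exp_of_nonneg (sq_nonneg ‖(u : E)‖)
  rw [← Submodule.norm_coe]
  nlinarith [sq_nonneg ‖(u : E)‖]

lemma norm_sq_smul_add_smul (v w : E) (x y : ℝ) :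
    ‖x • v + y • w‖ ^ 2 = x ^ 2 * ‖v‖ ^ 2 + 2 * (x * y) * inner ℝ v w + y ^ 2 * ‖w‖ ^ 2 := by
  rw [norm_add_sq_real, norm_smul, norm_smul, real_inner_smul_left, real_inner_smul_right,
    mul_pow, mul_pow, Real.norm_eq_abs, Real.norm_eq_abs, sq_abs, sq_abs]
  ring

/-- A Gauss-reduced basis `(v, w)` of a plane lattice. -/
structure IsReducedPair (L : Submodule ℤ E) (v w : E) : Prop where
  mem_iff : ∀ u, u ∈ L ↔ ∃ m n : ℤ, u = (m : ℝ) • v + (n : ℝ) • w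
  linearIndependent : LinearIndependent ℝ ![v, w]
  inner_nonneg : 0 ≤ inner ℝ v w
  norm_fst_le : ∀ u ∈ L, u ≠ 0 → ‖v‖ ≤ ‖u‖
  norm_snd_le : ∀ u ∈ L, (∀ n : ℤ, u ≠ (n : ℝ) • v) → ‖w‖ ≤ ‖u‖

lemma exists_mem_forall_ne_smul (L : Submodule ℤ E) [DiscreteTopology L]
    [IsZLattice ℝ L] (v : E) :
    ∃ u ∈ L, ∀ x : ℝ, u ≠ x • v := by
  by_contra! h
  have hle : Submodule.span ℝ (L : Set E) ≤ Submodule.span ℝ {v} := by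
    rw [Submodule.span_le]
    intro u hu
    obtain ⟨x, rfl⟩ := h u hu
    exact Submodule.smul_mem _ _ (Submodule.mem_span_singleton_self v)
  rw [IsZLattice.span_top, top_le_iff] at hle
  have h1 := finrank_span_le_card (R := ℝ) ({v} : Set E)
  rw [hle, finrank_top] at h1
  simp at h1

lemma exists_eq_smul_add_smul {v w : E} (h : LinearIndependent ℝ ![v, w]) (u : E) :
    ∃ x y : ℝ, u = x • v + y • w := by
  let b := basisOfLinearIndependentOfCardEqFinrank h (by simp)
  refine ⟨b.repr u 0, b.repr u 1, ?_⟩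
  conv_lhs => rw [← b.sum_repr u]
  simp [b, Fin.sum_univ_two]

lemma intCast_smul_mem {L : Submodule ℤ E} {u : E} (hu : u ∈ L) (n : ℤ) : (n : ℝ) • u ∈ L := by
  rw [Int.cast_smul_eq_zsmul]
  exact L.smul_mem n hu

lemma exists_isReducedPair (L : Submodule ℤ E) [DiscreteTopology L] [IsZLattice ℝ L] :
    ∃ v w, IsReducedPair L v w := by
  have hsum : Summable fun u : L => exp (-(‖(u : E)‖ ^ 2)) := summable_exp_neg_norm_sq L
  obtain ⟨⟨v, hvL⟩, hv0, hvmin⟩ := exists_min_of_summable_exp_neg hsum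
    (S := {u : L | (u : E) ≠ 0}) (by
      obtain ⟨u, hu, hu0⟩ := exists_mem_forall_ne_smul L 0
      exact ⟨⟨u, hu⟩, by simpa using hu0 0⟩)
  obtain ⟨⟨w₀, hw₀L⟩, hw₀, hw₀min⟩ := exists_min_of_summable_exp_neg hsum
    (S := {u : L | ∀ n : ℤ, (u : E) ≠ (n : ℝ) • v}) (by
      obtain ⟨u, hu, hu0⟩ := exists_mem_forall_ne_smul L v
      exact ⟨⟨u, hu⟩, fun n => hu0 n⟩)
  simp only [Set.mem_ofPred_eq] at hv0 hw₀
  have hv1 : ∀ u ∈ L, u ≠ 0 → ‖v‖ ≤ ‖u‖ := fun u hu hu0 =>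
    (sq_le_sq₀ (norm_nonneg _) (norm_nonneg _)).1 (hvmin ⟨u, hu⟩ hu0)
  obtain ⟨w, hwL, hwn, hwmin, hc⟩ : ∃ w ∈ L, (∀ n : ℤ, w ≠ (n : ℝ) • v) ∧
      (∀ u ∈ L, (∀ n : ℤ, u ≠ (n : ℝ) • v) → ‖w‖ ≤ ‖u‖) ∧ 0 ≤ inner ℝ v w := by
    have hmin : ∀ u ∈ L, (∀ n : ℤ, u ≠ (n : ℝ) • v) → ‖w₀‖ ≤ ‖u‖ := fun u hu hu0 =>
      (sq_le_sq₀ (norm_nonneg _) (norm_nonneg _)).1 (hw₀min ⟨u, hu⟩ hu0)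
    rcases le_total 0 (inner ℝ v w₀) with hc | hc
    · exact ⟨w₀, hw₀L, hw₀, hmin, hc⟩
    · refine ⟨-w₀, L.neg_mem hw₀L, fun n hn => hw₀ (-n) ?_, by simpa using hmin, by simpa using hc⟩
      rw [← neg_neg w₀, hn]; simp
  have hvpos : 0 < ‖v‖ := norm_pos_iff.2 hv0
  have hli : LinearIndependent ℝ ![v, w] := by
    rw [LinearIndependent.pair_iff' hv0]
    intro x hx
    refine hwn (round x) ?_
    by_contra hne
    have hmem : w - ((round x : ℤ) : ℝ) • v ∈ L := L.sub_mem hwL (intCast_smul_mem hvL _)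
    have hle := hv1 _ hmem (sub_ne_zero.2 hne)
    rw [← hx, ← sub_smul, norm_smul, Real.norm_eq_abs] at hle
    nlinarith [abs_sub_round x]
  have hvw : ‖v‖ ≤ ‖w‖ := hv1 w hwL fun h => hwn 0 (by simp [h])
  have h2c : 2 * inner ℝ v w ≤ ‖v‖ ^ 2 := by
    have h := hwmin (w - v) (L.sub_mem hwL hvL) fun n hn => hwn (n + 1) (by
      rw [sub_eq_iff_eq_add.1 hn]; push_cast; rw [add_smul, one_smul])
    have h' := (sq_le_sq₀ (norm_nonneg _) (norm_nonneg _)).2 h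
    rw [norm_sub_sq_real, real_inner_comm] at h'
    linarith
  refine ⟨v, w, fun u => ⟨fun hu => ?_, ?_⟩, hli, hc, hv1, hwmin⟩
  · obtain ⟨x, y, rfl⟩ := exists_eq_smul_add_smul hli u
    have hx := abs_sub_round x
    have hy := abs_sub_round y
    set p := x - round x with hp
    set q := y - round y with hq
    have hxy : p • v + q • w = x • v + y • w -
        (((round x : ℤ) : ℝ) • v + ((round y : ℤ) : ℝ) • w) := by
      rw [hp, hq, sub_smul, sub_smul]; abel
    have hmem : p • v + q • w ∈ L := by
      rw [hxy]
      exact L.sub_mem hu (L.add_mem (intCast_smul_mem hvL _) (intCast_smul_mem hwL _))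
    have hpar : ∃ n : ℤ, p • v + q • w = (n : ℝ) • v := by
      by_contra! hne
      have h := (sq_le_sq₀ (norm_nonneg _) (norm_nonneg _)).2 (hwmin _ hmem hne)
      rw [norm_sq_smul_add_smul] at h
      have hp2 : p ^ 2 ≤ 1 / 4 := by nlinarith [abs_le.1 hx]
      have hq2 : q ^ 2 ≤ 1 / 4 := by nlinarith [abs_le.1 hy]
      have hpq : p * q ≤ 1 / 4 := by nlinarith [sq_nonneg (p - q)]
      have hvw2 : ‖v‖ ^ 2 ≤ ‖w‖ ^ 2 := by gcongr
      have hv2 : 0 < ‖v‖ ^ 2 := by positivity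
      nlinarith [mul_le_mul_of_nonneg_right hp2 hv2.le,
        mul_le_mul_of_nonneg_right hq2 (hv2.le.trans hvw2), mul_le_mul_of_nonneg_right hpq hc]
    obtain ⟨n, hn⟩ := hpar
    have h0 : (p - n) • v + q • w = 0 := by
      rw [sub_smul, sub_add_eq_add_sub, hn, sub_self]
    obtain ⟨h1, h2⟩ := LinearIndependent.pair_iff.1 hli _ _ h0
    refine ⟨round x + n, round y, ?_⟩
    have hx' : x = ((round x + n : ℤ) : ℝ) := by push_cast; linarith
    have hy' : y = ((round y : ℤ) : ℝ) := by linarith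
    rw [← hx', ← hy']
  · rintro ⟨m, n, rfl⟩
    exact L.add_mem (intCast_smul_mem hvL _) (intCast_smul_mem hwL _)

namespace IsReducedPair

variable {L L' : Submodule ℤ E} {v w v' w' : E}

lemma fst_mem (h : IsReducedPair L v w) : v ∈ L := (h.mem_iff v).2 ⟨1, 0, by simp⟩

lemma snd_mem (h : IsReducedPair L v w) : w ∈ L := (h.mem_iff w).2 ⟨0, 1, by simp⟩

lemma fst_ne_zero (h : IsReducedPair L v w) : v ≠ 0 := h.linearIndependent.ne_zero 0

lemma snd_ne_smul_fst (h : IsReducedPair L v w) (x : ℝ) : w ≠ x • v := fun hx =>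
  (LinearIndependent.pair_iff' h.fst_ne_zero).1 h.linearIndependent x hx.symm

lemma covolume_sq [DiscreteTopology L] [IsZLattice ℝ L] (h : IsReducedPair L v w) :
    ZLattice.covolume L ^ 2 = ‖v‖ ^ 2 * ‖w‖ ^ 2 - inner ℝ v w ^ 2 := by
  let f : Fin 2 → L := ![⟨v, h.fst_mem⟩, ⟨w, h.snd_mem⟩]
  have hf : L.subtype ∘ f = ![v, w] := by
    ext i; fin_cases i <;> rfl
  have hli : LinearIndependent ℤ f := by
    refine LinearIndependent.of_comp L.subtype ?_
    rw [hf]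
    exact h.linearIndependent.restrict_scalars fun m n hmn => by simpa using hmn
  have hsp : ⊤ ≤ Submodule.span ℤ (Set.range f) := by
    rintro ⟨u, hu⟩ -
    obtain ⟨m, n, rfl⟩ := (h.mem_iff u).1 hu
    have : (⟨(m : ℝ) • v + (n : ℝ) • w, hu⟩ : L) = m • f 0 + n • f 1 := by
      ext1; simp [f, Int.cast_smul_eq_zsmul]
    rw [this]
    exact add_mem (Submodule.smul_mem _ _ (Submodule.subset_span ⟨0, rfl⟩))
      (Submodule.smul_mem _ _ (Submodule.subset_span ⟨1, rfl⟩))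
  have hvol : MeasureTheory.volume.real
      (ZSpan.fundamentalDomain (EuclideanSpace.basisFun (Fin 2) ℝ).toBasis) = 1 := by
    rw [MeasureTheory.measureReal_congr (ZSpan.fundamentalDomain_ae_parallelepiped _ _),
      MeasureTheory.measureReal_def, OrthonormalBasis.coe_toBasis,
      OrthonormalBasis.volume_parallelepiped, ENNReal.toReal_one]
  rw [ZLattice.covolume_eq_det_mul_measureReal L MeasureTheory.volume (Module.Basis.mk hli hsp)
    (EuclideanSpace.basisFun (Fin 2) ℝ).toBasis, hvol, mul_one, sq_abs, Module.Basis.coe_mk,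
    Module.Basis.det_apply, Matrix.det_fin_two]
  simp only [Module.Basis.toMatrix_apply, EuclideanSpace.norm_sq_eq, Fin.sum_univ_two,
    PiLp.inner_apply]
  simp [f]
  ring

lemma exists_isometry (h : IsReducedPair L v w) (h' : IsReducedPair L' v' w')
    (hv : ‖v‖ = ‖v'‖) (hw : ‖w‖ = ‖w'‖) (hvw : inner ℝ v w = inner ℝ v' w') :
    ∃ O : E ≃ₗᵢ[ℝ] E, O '' L = L' := by
  let b := basisOfLinearIndependentOfCardEqFinrank h.linearIndependent (by simp)
  let b' := basisOfLinearIndependentOfCardEqFinrank h'.linearIndependent (by simp)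
  let e : E ≃ₗ[ℝ] E := b.equiv b' (Equiv.refl _)
  have hev : e v = v' := by simpa [b, b'] using b.equiv_apply 0 b' (Equiv.refl _)
  have hew : e w = w' := by simpa [b, b'] using b.equiv_apply 1 b' (Equiv.refl _)
  have hexy : ∀ x y : ℝ, e (x • v + y • w) = x • v' + y • w' := fun x y => by
    rw [map_add, map_smul, map_smul, hev, hew]
  refine ⟨⟨e, fun u => ?_⟩, ?_⟩
  · obtain ⟨x, y, rfl⟩ := exists_eq_smul_add_smul h.linearIndependent u
    rw [hexy, ← sq_eq_sq₀ (norm_nonneg _) (norm_nonneg _), norm_sq_smul_add_smul,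
      norm_sq_smul_add_smul, hv, hw, hvw]
  · ext u
    simp only [Set.mem_image, SetLike.mem_coe]
    constructor
    · rintro ⟨u, hu, rfl⟩
      obtain ⟨m, n, rfl⟩ := (h.mem_iff u).1 hu
      exact (h'.mem_iff _).2 ⟨m, n, hexy m n⟩
    · intro hu
      obtain ⟨m, n, rfl⟩ := (h'.mem_iff u).1 hu
      exact ⟨_, (h.mem_iff _).2 ⟨m, n, rfl⟩, hexy m n⟩

section Theta

variable [DiscreteTopology L] [IsZLattice ℝ L] [DiscreteTopology L'] [IsZLattice ℝ L']

lemma norm_fst_le_of_theta_eq (h : IsReducedPair L v w) (h' : IsReducedPair L' v' w')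
    (hθ : ∀ s : ℝ, 1 ≤ s → ∑' u : L, exp (-(s * ‖(u : E)‖ ^ 2)) =
      ∑' u : L', exp (-(s * ‖(u : E)‖ ^ 2))) : ‖v'‖ ≤ ‖v‖ := by
  refine (sq_le_sq₀ (norm_nonneg _) (norm_nonneg _)).1 ?_
  refine le_of_tsum_exp_neg_mul_eq (g := fun _ : Unit => (0 : L)) (g' := fun _ : Unit => (0 : L'))
    (r := fun u : L => ‖(u : E)‖ ^ 2) (q := fun u : L' => ‖(u : E)‖ ^ 2) (i := ⟨v, h.fst_mem⟩)
    (summable_exp_neg_norm_sq L) (fun _ => sq_nonneg _) (summable_exp_neg_norm_sq L')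
    (fun _ => sq_nonneg _) (Function.injective_of_subsingleton _)
    (Function.injective_of_subsingleton _) (by simp) hθ ?_ ?_
  · rintro ⟨_, hu⟩
    exact h.fst_ne_zero (congrArg Subtype.val hu).symm
  · intro u hu
    have := h'.norm_fst_le u u.2 fun h0 => hu ⟨(), (Subtype.ext h0).symm⟩
    gcongr

lemma norm_snd_le_of_theta_eq (h : IsReducedPair L v w) (h' : IsReducedPair L' v' w')
    (hv : ‖v‖ = ‖v'‖)
    (hθ : ∀ s : ℝ, 1 ≤ s → ∑' u : L, exp (-(s * ‖(u : E)‖ ^ 2)) =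
      ∑' u : L', exp (-(s * ‖(u : E)‖ ^ 2))) : ‖w'‖ ≤ ‖w‖ := by
  have hinj : ∀ {M : Submodule ℤ E} {x : E} (hx : x ∈ M), x ≠ 0 →
      Function.Injective fun n : ℤ => (⟨(n : ℝ) • x, intCast_smul_mem hx n⟩ : M) := by
    intro M x hx hx0 m n hmn
    exact_mod_cast smul_left_injective ℝ hx0 (congrArg Subtype.val hmn)
  refine (sq_le_sq₀ (norm_nonneg _) (norm_nonneg _)).1 ?_
  refine le_of_tsum_exp_neg_mul_eq (r := fun u : L => ‖(u : E)‖ ^ 2)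
    (q := fun u : L' => ‖(u : E)‖ ^ 2) (i := ⟨w, h.snd_mem⟩)
    (summable_exp_neg_norm_sq L) (fun _ => sq_nonneg _) (summable_exp_neg_norm_sq L')
    (fun _ => sq_nonneg _) (hinj h.fst_mem h.fst_ne_zero) (hinj h'.fst_mem h'.fst_ne_zero)
    (fun n => by simp only [norm_smul, hv]) hθ ?_ ?_
  · rintro ⟨n, hn⟩
    exact h.snd_ne_smul_fst n (congrArg Subtype.val hn).symm
  · intro u hu
    have := h'.norm_snd_le u u.2 fun n hn => hu ⟨n, (Subtype.ext hn).symm⟩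
    gcongr

end Theta

end IsReducedPair

lemma exists_isometry_of_theta_eq (L L' : Submodule ℤ E) [DiscreteTopology L] [IsZLattice ℝ L]
    [DiscreteTopology L'] [IsZLattice ℝ L'] (hcov : ZLattice.covolume L = ZLattice.covolume L')
    (hθ : ∀ s : ℝ, 1 ≤ s → ∑' u : L, exp (-(s * ‖(u : E)‖ ^ 2)) =
      ∑' u : L', exp (-(s * ‖(u : E)‖ ^ 2))) :
    ∃ O : E ≃ₗᵢ[ℝ] E, O '' L = L' := by
  obtain ⟨v, w, h⟩ := exists_isReducedPair L
  obtain ⟨v', w', h'⟩ := exists_isReducedPair L'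
  have hθ' := fun s hs => (hθ s hs).symm
  have hv := le_antisymm (h'.norm_fst_le_of_theta_eq h hθ') (h.norm_fst_le_of_theta_eq h' hθ)
  have hw := le_antisymm (h'.norm_snd_le_of_theta_eq h hv.symm hθ')
    (h.norm_snd_le_of_theta_eq h' hv hθ)
  refine h.exists_isometry h' hv hw ?_
  rw [← sq_eq_sq₀ h.inner_nonneg h'.inner_nonneg]
  have h1 := h.covolume_sq
  have h2 := h'.covolume_sq
  rw [hcov, hv, hw] at h1
  linarith

end PlaneLattices

section Trace

open Filter Topology

local notation "E" => EuclideanSpace ℝ (Fin 2)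

variable {l l' : ℝ} {L L' : Submodule ℤ E}

/-- The squared length of the vector `(l n, u)` of the covering torus lattice. -/
noncomputable def torusNormSq (l : ℝ) (L : Submodule ℤ E) (p : ℤ × L) : ℝ :=
  l ^ 2 * (p.1 : ℝ) ^ 2 + ‖(p.2 : E)‖ ^ 2

/-- The squared length `(m + 1/2)² l²` of a screw motion along the first axis. -/
noncomputable def screwNormSq (l : ℝ) (m : ℤ) : ℝ := ((m : ℝ) + 1 / 2) ^ 2 * l ^ 2

lemma torusNormSq_nonneg (p : ℤ × L) : 0 ≤ torusNormSq l L p := by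
  unfold torusNormSq; positivity

lemma torusNormSq_zero : torusNormSq l L 0 = 0 := by simp [torusNormSq]

lemma torusNormSq_pos (hl : 0 < l) (p : ℤ × L) (hp : p ≠ 0) : 0 < torusNormSq l L p := by
  obtain ⟨n, u⟩ := p
  by_cases hn : n = 0
  · have hu : u ≠ 0 := fun hu => hp (by rw [hn, hu]; rfl)
    have : 0 < ‖(u : E)‖ := by simpa using hu
    unfold torusNormSq; positivity
  · have : (n : ℝ) ≠ 0 := by exact_mod_cast hn
    unfold torusNormSq; positivity

lemma le_screwNormSq (l : ℝ) (m : ℤ) : l ^ 2 / 4 ≤ screwNormSq l m := by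
  have h : (0 : ℝ) ≤ (m : ℝ) * (m + 1) := by
    have : (0 : ℤ) ≤ m * (m + 1) := by
      rcases le_or_gt 0 m with h | h
      · positivity
      · exact mul_nonneg_of_nonpos_of_nonpos h.le (by omega)
    exact_mod_cast this
  unfold screwNormSq
  nlinarith [mul_nonneg h (sq_nonneg l)]

lemma summable_exp_neg_mul_sq_sub (hl : 0 < l) :
    Summable fun n : ℤ => exp (-(l ^ 2 * (n : ℝ) ^ 2 - l ^ 2 * |(n : ℝ)|)) := by
  refine (summable_pow_mul_jacobiTheta₂_term_bound (l ^ 2 / (2 * π)) (T := l ^ 2 / π)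
    (by positivity) 0).congr fun n => ?_
  rw [pow_zero, one_mul]
  congr 1
  push_cast
  field_simp

lemma summable_exp_neg_torus_fst (hl : 0 < l) :
    Summable fun n : ℤ => exp (-(l ^ 2 * (n : ℝ) ^ 2)) := by
  refine (summable_exp_neg_mul_sq_sub hl).of_nonneg_of_le (fun _ => (exp_pos _).le) fun n => ?_
  have : 0 ≤ l ^ 2 * |(n : ℝ)| := by positivity
  gcongr
  linarith

lemma summable_exp_neg_screwNormSq (hl : 0 < l) :
    Summable fun m : ℤ => exp (-screwNormSq l m) := by
  refine (summable_exp_neg_mul_sq_sub hl).of_nonneg_of_le (fun _ => (exp_pos _).le) fun m => ?_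
  rw [exp_le_exp, screwNormSq]
  nlinarith [mul_nonneg (sq_nonneg l) (by linarith [neg_abs_le (m : ℝ)] : 0 ≤ |(m : ℝ)| + m),
    sq_nonneg l]

lemma exp_neg_mul_torusNormSq (s : ℝ) (p : ℤ × L) : exp (-(s * torusNormSq l L p)) =
    exp (-(s * (l ^ 2 * (p.1 : ℝ) ^ 2))) * exp (-(s * ‖(p.2 : E)‖ ^ 2)) := by
  rw [← exp_add, torusNormSq]; ring_nf

lemma summable_exp_neg_torusNormSq [DiscreteTopology L] [IsZLattice ℝ L] (hl : 0 < l) :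
    Summable fun p : ℤ × L => exp (-torusNormSq l L p) := by
  refine ((summable_exp_neg_torus_fst hl).mul_of_nonneg (summable_exp_neg_norm_sq L)
    (fun _ => (exp_pos _).le) fun _ => (exp_pos _).le).congr fun p => ?_
  simpa using (exp_neg_mul_torusNormSq (l := l) 1 p).symm

lemma tsum_exp_neg_mul_torusNormSq [DiscreteTopology L] [IsZLattice ℝ L] (hl : 0 < l) {s : ℝ}
    (hs : 1 ≤ s) : ∑' p, exp (-(s * torusNormSq l L p)) =
      (∑' n : ℤ, exp (-(s * (l ^ 2 * (n : ℝ) ^ 2)))) * ∑' u : L, exp (-(s * ‖(u : E)‖ ^ 2)) := by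
  rw [tsum_mul_tsum_of_summable_norm]
  · exact tsum_congr fun p => exp_neg_mul_torusNormSq s p
  · exact (summable_exp_neg_mul (summable_exp_neg_torus_fst hl) (m := 0)
      (fun n => by positivity) hs).norm
  · exact (summable_exp_neg_mul (summable_exp_neg_norm_sq L) (m := 0)
      (fun u => by positivity) hs).norm

lemma tsum_torus_lattice (hl : 0 < l) (t : ℝ) :
    ∑' v : {v : EuclideanSpace ℝ (Fin 3) | ∃ n : ℤ, ∃ u ∈ L,
        v = (WithLp.equiv 2 (Fin 3 → ℝ)).symm ![l * n, u 0, u 1]},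
      exp (-‖(v : EuclideanSpace ℝ (Fin 3))‖ ^ 2 / (4 * t)) =
    ∑' p, exp (-torusNormSq l L p / (4 * t)) := by
  let f : ℤ × L → EuclideanSpace ℝ (Fin 3) := fun p =>
    (WithLp.equiv 2 (Fin 3 → ℝ)).symm ![l * p.1, (p.2 : E) 0, (p.2 : E) 1]
  have hf : f.Injective := by
    rintro ⟨n, u⟩ ⟨n', u'⟩ h
    have h' := (WithLp.equiv 2 (Fin 3 → ℝ)).symm.injective h
    have h0 := congrFun h' 0
    have h1 := congrFun h' 1
    have h2 := congrFun h' 2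
    simp [hl.ne'] at h0 h1 h2
    refine Prod.ext h0 (Subtype.ext ?_)
    ext i
    fin_cases i
    · exact h1
    · exact h2
  have hrange : {v : EuclideanSpace ℝ (Fin 3) | ∃ n : ℤ, ∃ u ∈ L,
      v = (WithLp.equiv 2 (Fin 3 → ℝ)).symm ![l * n, u 0, u 1]} = Set.range f := by
    ext v
    constructor
    · rintro ⟨n, u, hu, rfl⟩
      exact ⟨(n, ⟨u, hu⟩), rfl⟩
    · rintro ⟨⟨n, u⟩, rfl⟩
      exact ⟨n, u, u.2, rfl⟩
  rw [hrange, tsum_range (fun v : EuclideanSpace ℝ (Fin 3) => exp (-‖v‖ ^ 2 / (4 * t))) hf]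
  refine tsum_congr fun p => ?_
  rw [torusNormSq, EuclideanSpace.norm_sq_eq, EuclideanSpace.norm_sq_eq, Fin.sum_univ_three,
    Fin.sum_univ_two]
  simp [f, mul_pow, add_assoc]

lemma M2trace_eq (hl : 0 < l) {s : ℝ} (hs : 0 < s) :
    (π / s) ^ ((3 : ℝ) / 2) * M2trace l L (1 / (4 * s)) =
      l / 2 * ZLattice.covolume L * ∑' p, exp (-(s * torusNormSq l L p)) +
      π / 2 * l * (s⁻¹ * ∑' m, exp (-(s * screwNormSq l m))) := by
  have hp : 0 < π / s := by positivity
  have h1 : 4 * π * (1 / (4 * s)) = π / s := by field_simp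
  have h2 : √(π * (1 / (4 * s))) = √(π / s) / 2 := by
    rw [show π * (1 / (4 * s)) = π / s / 2 ^ 2 by field_simp; norm_num, sqrt_div' _ (by positivity),
      sqrt_sq (by norm_num)]
  have h3 : (π / s) ^ ((3 : ℝ) / 2) = π / s * √(π / s) := by
    rw [sqrt_eq_rpow, ← rpow_one_add' hp.le (by norm_num)]; norm_num
  have h4 : ∀ x : ℝ, -x / (4 * (1 / (4 * s))) = -(s * x) := fun x => by field_simp
  have h5 : ∀ m : ℤ, -((m : ℝ) + 1 / 2) ^ 2 * l ^ 2 / (4 * (1 / (4 * s))) =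
      -(s * screwNormSq l m) := fun m => by
    rw [← h4, screwNormSq, neg_mul]
  have hsq : √(π / s) ≠ 0 := (sqrt_pos.2 hp).ne'
  rw [M2trace, tsum_torus_lattice hl]
  simp only [h1, h2, h3, h4, h5]
  field_simp
  ring

lemma tendsto_tsum_torusNormSq [DiscreteTopology L] [IsZLattice ℝ L] (hl : 0 < l) :
    Tendsto (fun s => ∑' p, exp (-(s * torusNormSq l L p))) atTop (𝓝 1) :=
  tendsto_tsum_exp_neg_mul_one (summable_exp_neg_torusNormSq hl) 0 torusNormSq_zero
    (torusNormSq_pos hl)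

lemma tendsto_inv_mul_tsum_screwNormSq (hl : 0 < l) :
    Tendsto (fun s => s⁻¹ * ∑' m, exp (-(s * screwNormSq l m))) atTop (𝓝 0) := by
  have h := tendsto_exp_mul_tsum_exp_neg_mul (summable_exp_neg_screwNormSq hl)
    (le_screwNormSq l) (R := 0) (by positivity)
  simpa using tendsto_inv_atTop_zero.mul h

variable [DiscreteTopology L] [IsZLattice ℝ L] [DiscreteTopology L'] [IsZLattice ℝ L']

lemma covolume_mul_eq_of_isospectral (hl : 0 < l) (hl' : 0 < l')
    (heq : ∀ t : ℝ, 0 < t → M2trace l L t = M2trace l' L' t) :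
    l / 2 * ZLattice.covolume L = l' / 2 * ZLattice.covolume L' := by
  have key : ∀ {l : ℝ} {L : Submodule ℤ E} [DiscreteTopology L] [IsZLattice ℝ L], 0 < l →
      Tendsto (fun s => (π / s) ^ ((3 : ℝ) / 2) * M2trace l L (1 / (4 * s))) atTop
        (𝓝 (l / 2 * ZLattice.covolume L)) := by
    intro l L _ _ hl
    have h := ((tendsto_tsum_torusNormSq (L := L) hl).const_mul
      (l / 2 * ZLattice.covolume L)).add
      ((tendsto_inv_mul_tsum_screwNormSq hl).const_mul (π / 2 * l))
    rw [mul_one, mul_zero, add_zero] at h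
    refine h.congr' ?_
    filter_upwards [eventually_gt_atTop 0] with s hs
    rw [M2trace_eq hl hs]
  refine tendsto_nhds_unique (key hl) ((key hl').congr' ?_)
  filter_upwards [eventually_gt_atTop 0] with s hs
  rw [heq _ (by positivity)]

lemma le_of_isospectral (hl : 0 < l) (hl' : 0 < l')
    (heq : ∀ t : ℝ, 0 < t → M2trace l L t = M2trace l' L' t) : l' ≤ l := by
  by_contra! hlt
  have hA := covolume_mul_eq_of_isospectral hl hl' heq
  set A := l / 2 * ZLattice.covolume L with hAdef
  have hA0 : 0 < A := by
    have := ZLattice.covolume_pos L MeasureTheory.volume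
    positivity
  have hψ := summable_exp_neg_screwNormSq hl
  set R := l ^ 2 / 4 with hR
  set ψ : ℝ → ℝ := fun s => ∑' m, exp (-(s * screwNormSq l m)) with hψdef
  set ψ' : ℝ → ℝ := fun s => ∑' m, exp (-(s * screwNormSq l' m)) with hψ'def
  set D : ℝ → ℝ := fun s => ∑' p, exp (-(s * torusNormSq l L p)) -
    ∑' p, exp (-(s * torusNormSq l' L' p)) with hD
  have hψ' : Tendsto (fun s => exp (s * R) * ψ' s) atTop (𝓝 0) :=
    tendsto_exp_mul_tsum_exp_neg_mul (summable_exp_neg_screwNormSq hl') (le_screwNormSq l')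
      (by rw [hR]; gcongr)
  have hDeq : ∀ s, 0 < s → D s = A⁻¹ * (π / 2) * (s⁻¹ * (l' * ψ' s - l * ψ s)) := by
    intro s hs
    have h1 := M2trace_eq (L := L) hl hs
    have h2 := M2trace_eq (L := L') hl' hs
    rw [heq _ (by positivity), h2, ← hA, ← hAdef] at h1
    have h3 : A * D s = π / 2 * (s⁻¹ * (l' * ψ' s - l * ψ s)) := by
      simp only [hD, hψdef, hψ'def]
      linear_combination -h1
    rw [mul_assoc, ← h3, inv_mul_cancel_left₀ hA0.ne']
  have hψbd : Tendsto (fun s => s⁻¹ * (exp (s * R) * ψ s)) atTop (𝓝 0) := by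
    have h := (tendsto_inv_atTop_zero (𝕜 := ℝ)).mul_const
      (exp R * ∑' m, exp (-screwNormSq l m))
    rw [zero_mul] at h
    refine squeeze_zero' ?_ ?_ h
    · filter_upwards [eventually_gt_atTop 0] with s hs
      have : 0 ≤ ψ s := tsum_nonneg fun _ => (exp_pos _).le
      positivity
    · filter_upwards [eventually_ge_atTop 1] with s hs
      have h1 : ψ s ≤ exp R * (∑' m, exp (-screwNormSq l m)) * exp (-(s * R)) :=
        tsum_exp_neg_mul_le_s12 hψ (le_screwNormSq l) hs
      rw [exp_neg, ← div_eq_mul_inv, le_div_iff₀ (exp_pos _), mul_comm] at h1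
      exact mul_le_mul_of_nonneg_left h1 (by positivity)
  have hlim : Tendsto (fun s => exp (s * R) * D s) atTop (𝓝 0) := by
    have h := (((tendsto_inv_atTop_zero (𝕜 := ℝ)).mul hψ').const_mul l').sub
      (hψbd.const_mul l) |>.const_mul (A⁻¹ * (π / 2))
    simp only [mul_zero, sub_zero] at h
    refine h.congr' ?_
    filter_upwards [eventually_gt_atTop 0] with s hs
    rw [hDeq s hs]; ring
  have hlim2 : Tendsto (fun s => s * (exp (s * R) * D s)) atTop (𝓝 0) :=
    tendsto_mul_exp_mul_tsum_sub (summable_exp_neg_torusNormSq hl) torusNormSq_nonneg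
      (summable_exp_neg_torusNormSq hl') torusNormSq_nonneg R hlim
  have hψ0 : Tendsto (fun s => exp (s * R) * ψ s) atTop (𝓝 0) := by
    have h := ((hψ'.const_mul l').sub (hlim2.const_mul (A * (2 / π)))).const_mul l⁻¹
    simp only [mul_zero, sub_zero] at h
    refine h.congr' ?_
    filter_upwards [eventually_gt_atTop 0] with s hs
    rw [hDeq s hs]
    field_simp
    ring
  have h1 : ∀ᶠ s in atTop, 1 ≤ exp (s * R) * ψ s := by
    filter_upwards [eventually_ge_atTop 1] with s hs
    have h2 : exp (-(s * screwNormSq l 0)) ≤ ψ s :=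
      (summable_exp_neg_mul hψ (le_screwNormSq l) hs).le_tsum 0 fun _ _ => (exp_pos _).le
    have h3 : screwNormSq l 0 = R := by rw [hR, screwNormSq]; push_cast; ring
    rw [h3] at h2
    calc (1 : ℝ) = exp (s * R) * exp (-(s * R)) := by rw [← exp_add]; simp
      _ ≤ _ := by gcongr
  exact absurd (ge_of_tendsto hψ0 h1) (by norm_num)

lemma theta_eq_of_isospectral (hl : 0 < l)
    (heq : ∀ t : ℝ, 0 < t → M2trace l L t = M2trace l L' t) {s : ℝ} (hs : 1 ≤ s) :
    ∑' u : L, exp (-(s * ‖(u : E)‖ ^ 2)) = ∑' u : L', exp (-(s * ‖(u : E)‖ ^ 2)) := by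
  have hA := covolume_mul_eq_of_isospectral hl hl heq
  have hcov := ZLattice.covolume_pos L MeasureTheory.volume
  have hs0 : 0 < s := one_pos.trans_le hs
  have h1 := M2trace_eq (L := L) hl hs0
  rw [heq _ (by positivity), M2trace_eq hl hs0, ← hA, add_left_inj,
    mul_right_inj' (by positivity), tsum_exp_neg_mul_torusNormSq hl hs,
    tsum_exp_neg_mul_torusNormSq hl hs] at h1
  refine (mul_left_cancel₀ (ne_of_gt ?_) h1).symm
  exact (summable_exp_neg_mul (summable_exp_neg_torus_fst hl) (m := 0)
    (fun n => by positivity) hs).tsum_pos (fun _ => (exp_pos _).le) 0 (exp_pos _)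

end Trace

/-- Case `M₂` of Theorem B: two flat 3-manifolds of type `M₂` with equal trace functions are
isometric, i.e. have the same `ℓ₁` and isometric plane lattices. -/
theorem M2_isospectral_implies_isometric
    (l₁ l₁' : ℝ) (hl₁ : 0 < l₁) (hl₁' : 0 < l₁')
    (L L' : Submodule ℤ (EuclideanSpace ℝ (Fin 2)))
    [DiscreteTopology L] [IsZLattice ℝ L] [DiscreteTopology L'] [IsZLattice ℝ L']
    (heq : ∀ t : ℝ, 0 < t → M2trace l₁ L t = M2trace l₁' L' t) :
    l₁ = l₁' ∧ ∃ O : EuclideanSpace ℝ (Fin 2) ≃ₗᵢ[ℝ] EuclideanSpace ℝ (Fin 2),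
      O '' L = L' := by
  obtain rfl : l₁ = l₁' := le_antisymm
    (le_of_isospectral hl₁' hl₁ fun t ht => (heq t ht).symm) (le_of_isospectral hl₁ hl₁' heq)
  refine ⟨rfl, exists_isometry_of_theta_eq L L' ?_ fun s hs => theta_eq_of_isospectral hl₁ heq hs⟩
  exact mul_left_cancel₀ (by positivity) (covolume_mul_eq_of_isospectral hl₁ hl₁ heq)
end

section
/- For a, b > 0 set Λ(a,b) = {(a m₁, b m₂, b m₃) : (m₁,m₂,m₃) ∈ ℤ³} and define, for t > 0, F_{a,b}(t) = ((a b²/4)/(4πt)^{3/2}) ∑_{v∈Λ(a,b)} e^{−‖v‖²/(4t)} + (a/(4√(πt))) ∑_{m∈ℤ} e^{−(m + 1/4)² a²/(4t)} + (a/(8√(πt))) ∑_{n∈ℤ} e^{−(n + 1/2)² a²/(4t)}. If a, b, a', b' > 0 satisfy F_{a,b}(t) = F_{a',b'}(t) for all t > 0, then a = a' and b = b'. -/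
open Real

/-- The rectangular lattice `Λ(a,b) = {(a m₁, b m₂, b m₃) : (m₁,m₂,m₃) ∈ ℤ³} ⊂ ℝ³`. -/
def M4lattice (a b : ℝ) : Set (EuclideanSpace ℝ (Fin 3)) :=
  {v | ∃ m : ℤ × ℤ × ℤ,
    v = (WithLp.equiv 2 (Fin 3 → ℝ)).symm ![a * m.1, b * m.2.1, b * m.2.2]}

/-- The trace function `tr(H_{M₄})` of the flat 3-manifold `M₄` with parameters `a, b`
(Theorem A), with `vol(M₄) = a b²/4`. -/
noncomputable def M4trace (a b t : ℝ) : ℝ :=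
  (a * b ^ 2 / 4) / (4 * π * t) ^ ((3:ℝ)/2) *
    (∑' v : M4lattice a b, Real.exp (-‖(v : EuclideanSpace ℝ (Fin 3))‖ ^ 2 / (4 * t))) +
  a / (4 * Real.sqrt (π * t)) *
    (∑' m : ℤ, Real.exp (-((m : ℝ) + 1/4) ^ 2 * a ^ 2 / (4 * t))) +
  a / (8 * Real.sqrt (π * t)) *
    (∑' n : ℤ, Real.exp (-((n : ℝ) + 1/2) ^ 2 * a ^ 2 / (4 * t)))

lemma summable_exp_neg_shifted_sq (r : ℝ) {c : ℝ} (hc : 0 < c) :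
    Summable fun m : ℤ => exp (-(((m : ℝ) + r) ^ 2 * c)) := by
  refine (HurwitzZeta.hasSum_int_evenKernel r (div_pos hc pi_pos)).summable.congr fun m => ?_
  congr 1
  field_simp

/-- The squared length of the vector `(a m₁, b m₂, b m₃)`. -/
def M4sqLength (a b : ℝ) (m : ℤ × ℤ × ℤ) : ℝ :=
  a ^ 2 * (m.1 : ℝ) ^ 2 + b ^ 2 * ((m.2.1 : ℝ) ^ 2 + (m.2.2 : ℝ) ^ 2)

lemma tsum_M4lattice {a b : ℝ} (ha : 0 < a) (hb : 0 < b) (f : ℝ → ℝ) :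
    ∑' v : M4lattice a b, f (‖(v : EuclideanSpace ℝ (Fin 3))‖ ^ 2) =
      ∑' m : ℤ × ℤ × ℤ, f (M4sqLength a b m) := by
  set φ : ℤ × ℤ × ℤ → EuclideanSpace ℝ (Fin 3) := fun m =>
    (WithLp.equiv 2 (Fin 3 → ℝ)).symm ![a * m.1, b * m.2.1, b * m.2.2] with hφ
  have hrange : M4lattice a b = Set.range φ := by
    ext v
    simp only [M4lattice, Set.mem_ofPred_eq, Set.mem_range, hφ, eq_comm]
  have hinj : Function.Injective φ := by
    rintro ⟨m₁, m₂, m₃⟩ ⟨n₁, n₂, n₃⟩ h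
    have h' := (WithLp.equiv 2 (Fin 3 → ℝ)).symm.injective h
    have h0 := congrFun h' 0
    have h1 := congrFun h' 1
    have h2 := congrFun h' 2
    simp [ha.ne', hb.ne'] at h0 h1 h2
    simp [h0, h1, h2]
  rw [hrange, tsum_range (fun v => f (‖v‖ ^ 2)) hinj]
  refine tsum_congr fun m => ?_
  congr 1
  simp [hφ, EuclideanSpace.norm_sq_eq, Fin.sum_univ_three, M4sqLength]
  ring

lemma summable_exp_neg_M4sqLength {a b x : ℝ} (ha : 0 < a) (hb : 0 < b) (hx : 0 < x) :
    Summable fun m : ℤ × ℤ × ℤ => exp (-(M4sqLength a b m * x)) := by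
  have h1 := summable_exp_neg_shifted_sq 0 (c := a ^ 2 * x) (by positivity)
  have h2 := summable_exp_neg_shifted_sq 0 (c := b ^ 2 * x) (by positivity)
  refine (h1.mul_of_nonneg (h2.mul_of_nonneg h2 (fun _ => (exp_pos _).le)
    fun _ => (exp_pos _).le) (fun _ => (exp_pos _).le) fun _ => by positivity).congr fun m => ?_
  rw [← exp_add, ← exp_add]
  congr 1
  simp only [M4sqLength]
  ring

lemma min_sq_le_M4sqLength (a b : ℝ) {m : ℤ × ℤ × ℤ} (hm : m ≠ 0) :
    min (a ^ 2) (b ^ 2) ≤ M4sqLength a b m := by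
  have one_le {k : ℤ} (hk : k ≠ 0) : (1 : ℝ) ≤ (k : ℝ) ^ 2 := by
    exact_mod_cast Int.add_one_le_of_lt (by positivity : 0 < k ^ 2)
  obtain ⟨m₁, m₂, m₃⟩ := m
  simp only [M4sqLength]
  have ha := sq_nonneg a
  have hb := sq_nonneg b
  have hp := mul_nonneg ha (sq_nonneg (m₁ : ℝ))
  have hq := mul_nonneg hb (sq_nonneg (m₂ : ℝ))
  have hr := mul_nonneg hb (sq_nonneg (m₃ : ℝ))
  by_cases h1 : m₁ = 0
  · refine (min_le_right _ _).trans ?_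
    by_cases h2 : m₂ = 0
    · have h3 : m₃ ≠ 0 := by
        rintro rfl
        exact hm (by simp [h1, h2])
      nlinarith [mul_le_mul_of_nonneg_left (one_le h3) hb]
    · nlinarith [mul_le_mul_of_nonneg_left (one_le h2) hb]
  · refine (min_le_left _ _).trans ?_
    nlinarith [mul_le_mul_of_nonneg_left (one_le h1) ha]

lemma exp_neg_mul_le_s13 {l μ x : ℝ} (hl : μ ≤ l) (hx : 1 ≤ x) :
    exp (-(l * x)) ≤ exp (-(l * 1)) * (exp μ * exp (-(μ * x))) := by
  rw [← exp_add, ← exp_add, exp_le_exp]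
  nlinarith [mul_nonneg (sub_nonneg.2 hl) (sub_nonneg.2 hx)]

lemma tsum_exp_neg_mul_le_s13 {ι : Type*} {l : ι → ℝ} {μ x : ℝ}
    (hs : ∀ y, 0 < y → Summable fun i => exp (-(l i * y))) (hl : ∀ i, μ ≤ l i) (hx : 1 ≤ x) :
    ∑' i, exp (-(l i * x)) ≤ (∑' i, exp (-(l i * 1))) * exp μ * exp (-(μ * x)) := by
  rw [mul_assoc, ← tsum_mul_right]
  exact (hs x (by linarith)).tsum_le_tsum (fun i => exp_neg_mul_le_s13 (hl i) hx)
    ((hs 1 one_pos).mul_right _)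

lemma tsum_exp_neg_mul_le_one_add {ι : Type*} {l : ι → ℝ} {μ x : ℝ} {i₀ : ι}
    (hs : ∀ y, 0 < y → Summable fun i => exp (-(l i * y))) (h0 : l i₀ = 0)
    (hl : ∀ i, i ≠ i₀ → μ ≤ l i) (hx : 1 ≤ x) :
    ∑' i, exp (-(l i * x)) ≤ 1 + (∑' i, exp (-(l i * 1))) * exp μ * exp (-(μ * x)) := by
  classical
  rw [(hs x (by linarith)).tsum_eq_add_tsum_ite i₀, h0, zero_mul, neg_zero, exp_zero,
    mul_assoc, ← tsum_mul_right]
  have hbound : ∀ i, (if i = i₀ then 0 else exp (-(l i * x))) ≤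
      exp (-(l i * 1)) * (exp μ * exp (-(μ * x))) := by
    intro i
    split_ifs with hi
    · positivity
    · exact exp_neg_mul_le_s13 (hl i hi) hx
  have hsum := (hs 1 one_pos).mul_right (exp μ * exp (-(μ * x)))
  refine add_le_add le_rfl (Summable.tsum_le_tsum hbound (hsum.of_nonneg_of_le ?_ hbound) hsum)
  intro i
  split_ifs <;> positivity

/-- The trace function in the variable `x = 1 / (4t)`, rescaled by `(4πt)^{3/2}`. -/
noncomputable def M4rescaledTrace (a b x : ℝ) : ℝ :=
  a * b ^ 2 / 4 * (∑' m : ℤ × ℤ × ℤ, exp (-(M4sqLength a b m * x))) +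
  π * a / 2 / x * (∑' m : ℤ, exp (-(((m : ℝ) + 1 / 4) ^ 2 * a ^ 2 * x))) +
  π * a / 4 / x * (∑' m : ℤ, exp (-(((m : ℝ) + 1 / 2) ^ 2 * a ^ 2 * x)))

lemma M4rescaledTrace_eq {a b x : ℝ} (ha : 0 < a) (hb : 0 < b) (hx : 0 < x) :
    M4rescaledTrace a b x = (π / x) ^ ((3 : ℝ) / 2) * M4trace a b (1 / (4 * x)) := by
  have hpx : 0 < π / x := by positivity
  have h1 : 4 * π * (1 / (4 * x)) = π / x := by field_simp
  have h2 : √(π * (1 / (4 * x))) = √(π / x) / 2 := by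
    rw [show π * (1 / (4 * x)) = π / x / 2 ^ 2 by field_simp; norm_num,
      sqrt_div hpx.le, sqrt_sq (by norm_num)]
  have h3 : (π / x) ^ ((3 : ℝ) / 2) = π / x * √(π / x) := by
    rw [show (3 : ℝ) / 2 = 1 + 1 / 2 by norm_num, rpow_add hpx, rpow_one, sqrt_eq_rpow]
  have h4 : ∀ y : ℝ, -y / (4 * (1 / (4 * x))) = -(y * x) := fun y => by field_simp
  have hs : 0 < √(π / x) := sqrt_pos.2 hpx
  have h5 := tsum_M4lattice ha hb (fun y => exp (-(y * x)))
  have h6 : ∀ y : ℝ, -y ^ 2 * a ^ 2 / (4 * (1 / (4 * x))) = -(y ^ 2 * a ^ 2 * x) :=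
    fun y => by field_simp
  simp only [M4trace, M4rescaledTrace, h1, h2, h3, h4, h6, h5]
  generalize (∑' m : ℤ × ℤ × ℤ, exp (-(M4sqLength a b m * x))) = S
  generalize (∑' m : ℤ, exp (-(((m : ℝ) + 1 / 4) ^ 2 * a ^ 2 * x))) = S₁
  generalize (∑' m : ℤ, exp (-(((m : ℝ) + 1 / 2) ^ 2 * a ^ 2 * x))) = S₂
  field_simp
  ring

lemma summable_exp_neg_shifted_sq_mul (r : ℝ) {a : ℝ} (ha : 0 < a) (y : ℝ) (hy : 0 < y) :
    Summable fun m : ℤ => exp (-(((m : ℝ) + r) ^ 2 * a ^ 2 * y)) := by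
  simpa only [mul_assoc] using summable_exp_neg_shifted_sq r (c := a ^ 2 * y) (by positivity)

lemma M4rescaledTrace_le {a b : ℝ} (ha : 0 < a) (hb : 0 < b) :
    ∃ C D : ℝ, ∀ x, 1 ≤ x → M4rescaledTrace a b x ≤
      a * b ^ 2 / 4 + C * exp (-(min (a ^ 2) (b ^ 2) * x)) + D / x * exp (-(a ^ 2 / 16 * x)) := by
  have hsq : ∀ m : ℤ, (1 : ℝ) / 16 ≤ ((m : ℝ) + 1 / 4) ^ 2 ∧
      (1 : ℝ) / 16 ≤ ((m : ℝ) + 1 / 2) ^ 2 := by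
    intro m
    rcases le_or_gt 0 m with h | h
    · have : (0 : ℝ) ≤ m := by exact_mod_cast h
      constructor <;> nlinarith
    · have : (m : ℝ) ≤ -1 := by exact_mod_cast Int.le_sub_one_of_lt h
      constructor <;> nlinarith
  refine ⟨a * b ^ 2 / 4 * ((∑' m, exp (-(M4sqLength a b m * 1))) * exp (min (a ^ 2) (b ^ 2))),
    π * a / 2 * ((∑' m : ℤ, exp (-(((m : ℝ) + 1 / 4) ^ 2 * a ^ 2 * 1))) * exp (a ^ 2 / 16)) +
    π * a / 4 * ((∑' m : ℤ, exp (-(((m : ℝ) + 1 / 2) ^ 2 * a ^ 2 * 1))) * exp (a ^ 2 / 16)),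
    fun x hx => ?_⟩
  have h1 := tsum_exp_neg_mul_le_one_add (i₀ := 0)
    (fun y hy => summable_exp_neg_M4sqLength ha hb hy) (by simp [M4sqLength])
    (fun m hm => min_sq_le_M4sqLength a b hm) hx
  have h2 := tsum_exp_neg_mul_le_s13 (μ := a ^ 2 / 16) (summable_exp_neg_shifted_sq_mul (1 / 4) ha)
    (fun m => by nlinarith [(hsq m).1, sq_nonneg a]) hx
  have h3 := tsum_exp_neg_mul_le_s13 (μ := a ^ 2 / 16) (summable_exp_neg_shifted_sq_mul (1 / 2) ha)
    (fun m => by nlinarith [(hsq m).2, sq_nonneg a]) hx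
  have hx0 : 0 < x := by linarith
  have g1 := mul_le_mul_of_nonneg_left h1 (by positivity : 0 ≤ a * b ^ 2 / 4)
  have g2 := mul_le_mul_of_nonneg_left h2 (by positivity : 0 ≤ π * a / 2 / x)
  have g3 := mul_le_mul_of_nonneg_left h3 (by positivity : 0 ≤ π * a / 4 / x)
  refine (add_le_add (add_le_add g1 g2) g3).trans (le_of_eq ?_)
  ring

lemma le_M4rescaledTrace {a b x : ℝ} (ha : 0 < a) (hb : 0 < b) (hx : 0 < x) :
    a * b ^ 2 / 4 + a * b ^ 2 / 4 * exp (-(b ^ 2 * x)) + π * a / 2 / x * exp (-(a ^ 2 / 16 * x)) ≤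
      M4rescaledTrace a b x := by
  have h1 := (summable_exp_neg_M4sqLength ha hb hx).sum_le_tsum {(0, 0, 0), (0, 1, 0)}
    fun _ _ => (exp_pos _).le
  rw [Finset.sum_pair (by decide)] at h1
  have h2 := (summable_exp_neg_shifted_sq_mul (1 / 4) ha x hx).le_tsum 0
    fun _ _ => (exp_pos _).le
  have h3 : 0 ≤ ∑' m : ℤ, exp (-(((m : ℝ) + 1 / 2) ^ 2 * a ^ 2 * x)) :=
    tsum_nonneg fun _ => (exp_pos _).le
  have e0 : M4sqLength a b (0, 0, 0) = 0 := by simp [M4sqLength]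
  have e1 : M4sqLength a b (0, 1, 0) = b ^ 2 := by simp [M4sqLength]
  have e2 : (((0 : ℤ) : ℝ) + 1 / 4) ^ 2 * a ^ 2 = a ^ 2 / 16 := by push_cast; ring
  rw [e0, e1, zero_mul, neg_zero, exp_zero] at h1
  rw [e2] at h2
  have g1 := mul_le_mul_of_nonneg_left h1 (by positivity : 0 ≤ a * b ^ 2 / 4)
  have g2 := mul_le_mul_of_nonneg_left h2 (by positivity : 0 ≤ π * a / 2 / x)
  have g3 := mul_nonneg (by positivity : 0 ≤ π * a / 4 / x) h3
  unfold M4rescaledTrace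
  linarith

open Filter Topology

lemma tendsto_exp_neg_mul_atTop {c : ℝ} (hc : 0 < c) :
    Tendsto (fun x : ℝ => exp (-(c * x))) atTop (𝓝 0) :=
  tendsto_exp_neg_atTop_nhds_zero.comp (tendsto_id.const_mul_atTop hc)

lemma tendsto_M4rescaledTrace {a b : ℝ} (ha : 0 < a) (hb : 0 < b) :
    Tendsto (M4rescaledTrace a b) atTop (𝓝 (a * b ^ 2 / 4)) := by
  obtain ⟨C, D, h⟩ := M4rescaledTrace_le ha hb
  have hmin : 0 < min (a ^ 2) (b ^ 2) := lt_min (by positivity) (by positivity)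
  have hlim : Tendsto (fun x : ℝ => a * b ^ 2 / 4 + C * exp (-(min (a ^ 2) (b ^ 2) * x)) +
      D / x * exp (-(a ^ 2 / 16 * x))) atTop (𝓝 (a * b ^ 2 / 4)) := by
    simpa using (tendsto_const_nhds.add ((tendsto_exp_neg_mul_atTop hmin).const_mul C)).add
      ((tendsto_id.const_div_atTop D).mul
        (tendsto_exp_neg_mul_atTop (by positivity : 0 < a ^ 2 / 16)))
  refine tendsto_of_tendsto_of_tendsto_of_le_of_le' tendsto_const_nhds hlim ?_ ?_
  · filter_upwards [eventually_gt_atTop 0] with x hx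
    refine le_trans ?_ (le_M4rescaledTrace ha hb hx)
    rw [add_assoc, le_add_iff_nonneg_right]
    positivity
  · filter_upwards [eventually_ge_atTop 1] with x hx using h x hx

lemma M4rescaledTrace_not_eq_of_lt {a b a' b' : ℝ} (ha : 0 < a) (hb : 0 < b) (ha' : 0 < a')
    (hb' : 0 < b') (hlt : a < a') :
    ¬ ∀ x, 0 < x → M4rescaledTrace a b x = M4rescaledTrace a' b' x := by
  intro heq
  have hvol : a * b ^ 2 / 4 = a' * b' ^ 2 / 4 := by
    refine tendsto_nhds_unique (tendsto_M4rescaledTrace ha hb)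
      ((tendsto_M4rescaledTrace ha' hb').congr' ?_)
    filter_upwards [eventually_gt_atTop 0] with x hx using (heq x hx).symm
  have hbb : b' < b := by
    by_contra! h
    have := mul_le_mul_of_nonneg_left (pow_le_pow_left₀ hb.le h 2) ha.le
    nlinarith [mul_lt_mul_of_pos_right hlt (by positivity : 0 < b' ^ 2)]
  rcases le_or_gt b' (a / 4) with hcase | hcase
  · obtain ⟨C, D, h⟩ := M4rescaledTrace_le ha hb
    have hδ : 0 < min (a ^ 2) (b ^ 2) - b' ^ 2 :=
      sub_pos.2 (lt_min (by nlinarith) (by nlinarith))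
    have hε : 0 ≤ a ^ 2 / 16 - b' ^ 2 := by nlinarith
    have hlim : Tendsto (fun x : ℝ => C * exp (-((min (a ^ 2) (b ^ 2) - b' ^ 2) * x)) + |D| / x)
        atTop (𝓝 0) := by
      simpa using ((tendsto_exp_neg_mul_atTop hδ).const_mul C).add
        (tendsto_id.const_div_atTop |D|)
    refine absurd (ge_of_tendsto hlim (b := a' * b' ^ 2 / 4) ?_)
      (not_le.2 (by positivity))
    filter_upwards [eventually_ge_atTop 1] with x hx
    have hx0 : 0 < x := by linarith
    have hup := h x hx
    have hlow := le_M4rescaledTrace ha' hb' hx0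
    rw [heq x hx0] at hup
    have hpos : 0 ≤ π * a' / 2 / x * exp (-(a' ^ 2 / 16 * x)) := by positivity
    have key : a' * b' ^ 2 / 4 * exp (-(b' ^ 2 * x)) ≤
        C * exp (-(min (a ^ 2) (b ^ 2) * x)) + D / x * exp (-(a ^ 2 / 16 * x)) := by linarith
    have key' := mul_le_mul_of_nonneg_right key (exp_pos (b' ^ 2 * x)).le
    rw [add_mul, mul_assoc, mul_assoc, mul_assoc, ← exp_add, ← exp_add, ← exp_add,
      neg_add_cancel, exp_zero, mul_one] at key'
    have hle : D / x * exp (-(a ^ 2 / 16 * x) + b' ^ 2 * x) ≤ |D| / x := by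
      have : exp (-(a ^ 2 / 16 * x) + b' ^ 2 * x) ≤ 1 := by
        rw [exp_le_one_iff]
        nlinarith [mul_nonneg hε hx0.le]
      calc _ ≤ |D| / x * exp (-(a ^ 2 / 16 * x) + b' ^ 2 * x) := by
            gcongr
            exact le_abs_self D
        _ ≤ |D| / x := mul_le_of_le_one_right (by positivity) this
    rw [show -((min (a ^ 2) (b ^ 2) - b' ^ 2) * x) = -(min (a ^ 2) (b ^ 2) * x) + b' ^ 2 * x by
      ring]
    linarith
  · obtain ⟨C, D, h⟩ := M4rescaledTrace_le ha' hb'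
    have hδ : 0 < min (a' ^ 2) (b' ^ 2) - a ^ 2 / 16 :=
      sub_pos.2 (lt_min (by nlinarith) (by nlinarith))
    have hε : 0 < a' ^ 2 / 16 - a ^ 2 / 16 := by nlinarith
    have hlim : Tendsto (fun x : ℝ =>
        C * (x * exp (-((min (a' ^ 2) (b' ^ 2) - a ^ 2 / 16) * x))) +
          D * exp (-((a' ^ 2 / 16 - a ^ 2 / 16) * x))) atTop (𝓝 0) := by
      have hx : Tendsto (fun x : ℝ => x * exp (-((min (a' ^ 2) (b' ^ 2) - a ^ 2 / 16) * x)))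
          atTop (𝓝 0) := by
        simpa only [neg_mul, rpow_one] using tendsto_rpow_mul_exp_neg_mul_atTop_nhds_zero 1 _ hδ
      simpa using (hx.const_mul C).add ((tendsto_exp_neg_mul_atTop hε).const_mul D)
    refine absurd (ge_of_tendsto hlim (b := π * a / 2) ?_) (not_le.2 (by positivity))
    filter_upwards [eventually_ge_atTop 1] with x hx
    have hx0 : 0 < x := by linarith
    have hup := h x hx
    have hlow := le_M4rescaledTrace ha hb hx0
    rw [← heq x hx0] at hup
    have hpos : 0 ≤ a * b ^ 2 / 4 * exp (-(b ^ 2 * x)) := by positivity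
    have key : π * a / 2 / x * exp (-(a ^ 2 / 16 * x)) ≤
        C * exp (-(min (a' ^ 2) (b' ^ 2) * x)) + D / x * exp (-(a' ^ 2 / 16 * x)) := by linarith
    have key' := mul_le_mul_of_nonneg_right key
      (mul_pos hx0 (exp_pos (a ^ 2 / 16 * x))).le
    have split : ∀ c : ℝ, exp (-((c - a ^ 2 / 16) * x)) =
        exp (-(c * x)) * exp (a ^ 2 / 16 * x) := fun c => by
      rw [← exp_add]
      ring_nf
    have hone : exp (-(a ^ 2 / 16 * x)) * exp (a ^ 2 / 16 * x) = 1 := by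
      rw [← exp_add, neg_add_cancel, exp_zero]
    rw [split, split]
    calc π * a / 2 = π * a / 2 / x * x *
          (exp (-(a ^ 2 / 16 * x)) * exp (a ^ 2 / 16 * x)) := by
          rw [hone, div_mul_cancel₀ _ hx0.ne', mul_one]
      _ = π * a / 2 / x * exp (-(a ^ 2 / 16 * x)) * (x * exp (a ^ 2 / 16 * x)) := by
          ac_rfl
      _ ≤ _ := key'
      _ = _ := by field_simp

/-- Case `M₄` of Theorem B: two flat 3-manifolds of type `M₄` with equal trace functions
have the same parameters. -/
theorem M4_isospectral_implies_isometric
    (a b a' b' : ℝ) (ha : 0 < a) (hb : 0 < b) (ha' : 0 < a') (hb' : 0 < b')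
    (heq : ∀ t : ℝ, 0 < t → M4trace a b t = M4trace a' b' t) :
    a = a' ∧ b = b' := by
  have hG : ∀ x, 0 < x → M4rescaledTrace a b x = M4rescaledTrace a' b' x := fun x hx => by
    rw [M4rescaledTrace_eq ha hb hx, M4rescaledTrace_eq ha' hb' hx, heq _ (by positivity)]
  have haa : a = a' := by
    rcases lt_trichotomy a a' with h | h | h
    · exact absurd hG (M4rescaledTrace_not_eq_of_lt ha hb ha' hb' h)
    · exact h
    · exact absurd (fun x hx => (hG x hx).symm) (M4rescaledTrace_not_eq_of_lt ha' hb' ha hb h)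
  subst haa
  refine ⟨rfl, ?_⟩
  have hvol : a * b ^ 2 / 4 = a * b' ^ 2 / 4 := by
    refine tendsto_nhds_unique (tendsto_M4rescaledTrace ha hb)
      ((tendsto_M4rescaledTrace ha hb').congr' ?_)
    filter_upwards [eventually_gt_atTop 0] with x hx using (hG x hx).symm
  have hsq : b ^ 2 = b' ^ 2 := mul_left_cancel₀ ha.ne' (by linarith)
  exact (pow_left_inj₀ hb.le hb'.le two_ne_zero).1 hsq
end

section
/- For positive reals a₁, a₂, a₃ set Λ(a₁,a₂,a₃) = {(a₁m₁, a₂m₂, a₃m₃) : (m₁,m₂,m₃) ∈ ℤ³} and define, for t > 0, F_{a₁,a₂,a₃}(t) = ((a₁a₂a₃/4)/(4πt)^{3/2}) ∑_{v∈Λ(a₁,a₂,a₃)} e^{−‖v‖²/(4t)} + ∑_{i=1}^{3} (a_i/(8√(πt))) ∑_{m∈ℤ} e^{−(m + 1/2)² a_i²/(4t)}. If (a₁,a₂,a₃) and (b₁,b₂,b₃) are triples of positive reals with F_{a₁,a₂,a₃}(t) = F_{b₁,b₂,b₃}(t) for all t > 0, then the multiset {a₁,a₂,a₃} equals the multiset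 {b₁,b₂,b₃}. -/
open Real

/-- The rectangular lattice `Λ(a₁,a₂,a₃) = {(a₁m₁, a₂m₂, a₃m₃) : (m₁,m₂,m₃) ∈ ℤ³} ⊂ ℝ³`. -/
def rectLattice (a₁ a₂ a₃ : ℝ) : Set (EuclideanSpace ℝ (Fin 3)) :=
  {v | ∃ m : ℤ × ℤ × ℤ,
    v = (WithLp.equiv 2 (Fin 3 → ℝ)).symm ![a₁ * m.1, a₂ * m.2.1, a₃ * m.2.2]}

/-- The trace function `tr(H_{M₆})` of the flat 3-manifold `M₆` with right-angled covering
torus lattice of side lengths `a₁, a₂, a₃` and `vol(M₆) = a₁a₂a₃/4` (Theorem A). -/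
noncomputable def M6trace (a₁ a₂ a₃ t : ℝ) : ℝ :=
  (a₁ * a₂ * a₃ / 4) / (4 * π * t) ^ ((3:ℝ)/2) *
    (∑' v : rectLattice a₁ a₂ a₃, Real.exp (-‖(v : EuclideanSpace ℝ (Fin 3))‖ ^ 2 / (4 * t))) +
  a₁ / (8 * Real.sqrt (π * t)) *
    (∑' m : ℤ, Real.exp (-((m : ℝ) + 1/2) ^ 2 * a₁ ^ 2 / (4 * t))) +
  a₂ / (8 * Real.sqrt (π * t)) *
    (∑' m : ℤ, Real.exp (-((m : ℝ) + 1/2) ^ 2 * a₂ ^ 2 / (4 * t))) +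
  a₃ / (8 * Real.sqrt (π * t)) *
    (∑' m : ℤ, Real.exp (-((m : ℝ) + 1/2) ^ 2 * a₃ ^ 2 / (4 * t)))

open Filter Topology

/-- The theta series `∑ₘ exp (-s (a m)²)` of the lattice `aℤ`. -/
noncomputable def latticeTheta (s a : ℝ) : ℝ := ∑' m : ℤ, Real.exp (-s * (a * m) ^ 2)

/-- The theta series of the shifted lattice `a(ℤ + 1/2)`, weighted by `a`. -/
noncomputable def shiftedTheta (s a : ℝ) : ℝ :=
  a * ∑' m : ℤ, Real.exp (-s * (a * (m + 1 / 2)) ^ 2)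

/-- The trace function of `M₆`, rescaled by `(4πt)^{3/2}`, as a function of the multiset of side
lengths and of `s = 1/(4t)`. -/
noncomputable def rescaledTrace (A : Multiset ℝ) (s : ℝ) : ℝ :=
  A.prod / 4 * (A.map (latticeTheta s)).prod + π / (4 * s) * (A.map (shiftedTheta s)).sum

lemma summable_exp_neg_mul_shift_sq (c : ℝ) {s a : ℝ} (hs : 0 < s) (ha : 0 < a) :
    Summable fun m : ℤ => Real.exp (-s * (a * (m + c)) ^ 2) := by
  have h := (HurwitzZeta.hasSum_int_evenKernel c
    (show 0 < s * a ^ 2 / π by positivity)).summable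
  refine h.congr fun m => ?_
  congr 1
  field_simp

lemma summable_latticeTheta {s a : ℝ} (hs : 0 < s) (ha : 0 < a) :
    Summable fun m : ℤ => Real.exp (-s * (a * m) ^ 2) := by
  simpa using summable_exp_neg_mul_shift_sq 0 hs ha

lemma tsum_exp_neg_mul_le_s14 {ι : Type*} {q : ι → ℝ} {δ s : ℝ} (hq : ∀ i, δ ≤ q i)
    (hsum : Summable fun i => Real.exp (-q i)) (hs : 1 ≤ s) :
    ∑' i, Real.exp (-s * q i) ≤ Real.exp (-s * δ) * (Real.exp δ * ∑' i, Real.exp (-q i)) := by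
  have hle : ∀ i, Real.exp (-s * q i) ≤
      Real.exp (-s * δ) * (Real.exp δ * Real.exp (-q i)) := fun i => by
    rw [← Real.exp_add, ← Real.exp_add]
    gcongr
    nlinarith [mul_nonneg (sub_nonneg.2 hs) (sub_nonneg.2 (hq i))]
  have hsum' := (hsum.mul_left (Real.exp δ)).mul_left (Real.exp (-s * δ))
  rw [← tsum_mul_left, ← tsum_mul_left]
  exact (Summable.of_nonneg_of_le (fun _ => (Real.exp_pos _).le) hle hsum').tsum_le_tsum hle hsum'

lemma latticeTheta_eq_one_add {s a : ℝ} (hs : 0 < s) (ha : 0 < a) :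
    latticeTheta s a = 1 + ∑' m : {m : ℤ // m ≠ 0}, Real.exp (-s * (a * (m : ℤ)) ^ 2) := by
  have h := (summable_latticeTheta hs ha).tsum_subtype_add_tsum_subtype_compl {0}
  rw [latticeTheta, ← h]
  congr 1
  rw [tsum_singleton (0 : ℤ) fun m : ℤ => Real.exp (-s * (a * m) ^ 2)]
  simp

lemma one_le_latticeTheta {s a : ℝ} (hs : 0 < s) (ha : 0 < a) : 1 ≤ latticeTheta s a := by
  rw [latticeTheta_eq_one_add hs ha]
  exact le_add_of_nonneg_right (tsum_nonneg fun _ => (Real.exp_pos _).le)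

lemma shiftedTheta_nonneg {s a : ℝ} (ha : 0 < a) : 0 ≤ shiftedTheta s a :=
  mul_nonneg ha.le (tsum_nonneg fun _ => (Real.exp_pos _).le)

lemma le_shiftedTheta {s a : ℝ} (hs : 0 < s) (ha : 0 < a) :
    a * Real.exp (-(s * (a ^ 2 / 4))) ≤ shiftedTheta s a := by
  refine mul_le_mul_of_nonneg_left ?_ ha.le
  refine le_trans (le_of_eq ?_) ((summable_exp_neg_mul_shift_sq (1 / 2) hs ha).le_tsum 0
    fun _ _ => (Real.exp_pos _).le)
  congr 1
  push_cast
  ring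

lemma exists_latticeTheta_sub_one_le {a : ℝ} (ha : 0 < a) :
    ∃ C, ∀ s, 1 ≤ s → latticeTheta s a - 1 ≤ Real.exp (-s * a ^ 2) * C := by
  refine ⟨Real.exp (a ^ 2) * ∑' m : {m : ℤ // m ≠ 0}, Real.exp (-((a * (m : ℤ)) ^ 2)),
    fun s hs => ?_⟩
  rw [latticeTheta_eq_one_add (by linarith) ha, add_sub_cancel_left]
  refine tsum_exp_neg_mul_le_s14 (q := fun m : {m : ℤ // m ≠ 0} => (a * (m : ℤ)) ^ 2)
    (fun m => ?_) ?_ hs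
  · have h : (1 : ℝ) ≤ (m : ℤ) ^ 2 := by
      exact_mod_cast Int.add_one_le_iff.2 (sq_pos_of_ne_zero m.2)
    nlinarith [sq_nonneg a]
  · refine ((summable_latticeTheta one_pos ha).subtype {m : ℤ | m ≠ 0}).congr fun m => ?_
    rw [Function.comp_apply, neg_one_mul]

lemma exists_shiftedTheta_le {a : ℝ} (ha : 0 < a) :
    ∃ C, ∀ s, 1 ≤ s → shiftedTheta s a ≤ Real.exp (-s * (a ^ 2 / 4)) * C := by
  refine ⟨a * (Real.exp (a ^ 2 / 4) * ∑' m : ℤ, Real.exp (-((a * (m + 1 / 2)) ^ 2))),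
    fun s hs => ?_⟩
  rw [shiftedTheta, mul_left_comm]
  refine mul_le_mul_of_nonneg_left ?_ ha.le
  refine tsum_exp_neg_mul_le_s14 (q := fun m : ℤ => (a * (m + 1 / 2)) ^ 2) (fun m => ?_) ?_ hs
  · have h : (0 : ℝ) ≤ m * (m + 1) := by
      have : 0 ≤ m * (m + 1) := by
        rcases le_or_gt 0 m with h | h
        · positivity
        · nlinarith
      exact_mod_cast this
    nlinarith [mul_nonneg (sq_nonneg a) h]
  · simpa using summable_exp_neg_mul_shift_sq (1 / 2) one_pos ha

lemma tendsto_mul_exp_neg_mul_atTop {d : ℝ} (hd : 0 < d) :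
    Tendsto (fun s : ℝ => s * Real.exp (-d * s)) atTop (𝓝 0) := by
  simpa using tendsto_rpow_mul_exp_neg_mul_atTop_nhds_zero 1 d hd

lemma tendsto_exp_mul_shiftedTheta {x y : ℝ} (hx : 0 ≤ x) (hxy : x < y) :
    Tendsto (fun s => Real.exp (s * (x ^ 2 / 4)) * shiftedTheta s y) atTop (𝓝 0) := by
  obtain ⟨C, hC⟩ := exists_shiftedTheta_le (hx.trans_lt hxy)
  have hd : 0 < y ^ 2 / 4 - x ^ 2 / 4 := by nlinarith
  have hlim : Tendsto (fun s : ℝ => Real.exp (-(s * (y ^ 2 / 4 - x ^ 2 / 4))) * C)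
      atTop (𝓝 0) := by
    simpa using (Real.tendsto_exp_neg_atTop_nhds_zero.comp
      (tendsto_id.atTop_mul_const hd)).mul_const C
  refine squeeze_zero' (Eventually.of_forall fun s =>
    mul_nonneg (Real.exp_pos _).le (shiftedTheta_nonneg (hx.trans_lt hxy))) ?_ hlim
  filter_upwards [eventually_ge_atTop 1] with s hs
  refine (mul_le_mul_of_nonneg_left (hC s hs) (Real.exp_pos _).le).trans (le_of_eq ?_)
  rw [← mul_assoc, ← Real.exp_add]
  ring_nf

lemma tendsto_exp_mul_latticeTheta_sub_one {x y : ℝ} (hx : 0 ≤ x) (hxy : x < y) :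
    Tendsto (fun s => s * Real.exp (s * (x ^ 2 / 4)) * (latticeTheta s y - 1)) atTop (𝓝 0) := by
  obtain ⟨C, hC⟩ := exists_latticeTheta_sub_one_le (hx.trans_lt hxy)
  have hd : 0 < y ^ 2 - x ^ 2 / 4 := by nlinarith
  have hlim := (tendsto_mul_exp_neg_mul_atTop hd).mul_const C
  rw [zero_mul] at hlim
  refine squeeze_zero' ?_ ?_ hlim
  · filter_upwards [eventually_ge_atTop 1] with s hs
    have := one_le_latticeTheta (show 0 < s by linarith) (hx.trans_lt hxy)
    exact mul_nonneg (by positivity) (by linarith)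
  · filter_upwards [eventually_ge_atTop 1] with s hs
    refine (mul_le_mul_of_nonneg_left (hC s hs) (by positivity)).trans (le_of_eq ?_)
    rw [← mul_assoc, mul_assoc s, ← Real.exp_add]
    ring_nf

lemma tendsto_latticeTheta {a : ℝ} (ha : 0 < a) :
    Tendsto (fun s => latticeTheta s a) atTop (𝓝 1) := by
  have h : Tendsto (fun s => latticeTheta s a - 1) atTop (𝓝 0) := by
    have h0 := tendsto_exp_mul_latticeTheta_sub_one le_rfl ha
    refine squeeze_zero' ?_ ?_ h0
    · filter_upwards [eventually_ge_atTop 1] with s hs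
      linarith [one_le_latticeTheta (show 0 < s by linarith) ha]
    · filter_upwards [eventually_ge_atTop 1] with s hs
      have := one_le_latticeTheta (show 0 < s by linarith) ha
      simp only [ne_eq, OfNat.ofNat_ne_zero, not_false_eq_true, zero_pow, zero_div, mul_zero,
        Real.exp_zero, mul_one]
      nlinarith
  simpa using h.add_const 1

lemma tendsto_prod_latticeTheta {A : Multiset ℝ} (hA : ∀ a ∈ A, 0 < a) :
    Tendsto (fun s => (A.map (latticeTheta s)).prod) atTop (𝓝 1) := by
  simpa using tendsto_multiset_prod A fun a ha => tendsto_latticeTheta (hA a ha)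

lemma tendsto_exp_mul_prod_latticeTheta_sub_one {x : ℝ} (hx : 0 ≤ x) {A : Multiset ℝ}
    (hA : ∀ a ∈ A, x < a) :
    Tendsto (fun s => s * Real.exp (s * (x ^ 2 / 4)) * ((A.map (latticeTheta s)).prod - 1))
      atTop (𝓝 0) := by
  induction A using Multiset.induction_on with
  | empty => simp
  | cons a A ih =>
    have hA' : ∀ b ∈ A, x < b := fun b hb => hA b (Multiset.mem_cons_of_mem hb)
    have h := ((tendsto_exp_mul_latticeTheta_sub_one hx (hA a (Multiset.mem_cons_self a A))).mul
      (tendsto_prod_latticeTheta fun b hb => hx.trans_lt (hA' b hb))).add (ih hA')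
    rw [zero_mul, zero_add] at h
    refine h.congr fun s => ?_
    rw [Multiset.map_cons, Multiset.prod_cons]
    ring

lemma tendsto_exp_mul_sum_shiftedTheta {x : ℝ} (hx : 0 ≤ x) {A : Multiset ℝ}
    (hA : ∀ a ∈ A, x < a) :
    Tendsto (fun s => Real.exp (s * (x ^ 2 / 4)) * (A.map (shiftedTheta s)).sum)
      atTop (𝓝 0) := by
  simpa [Multiset.sum_map_mul_left] using
    tendsto_multiset_sum A fun a ha => tendsto_exp_mul_shiftedTheta hx (hA a ha)

lemma tendsto_rescaledTrace {A : Multiset ℝ} (hA : ∀ a ∈ A, 0 < a) :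
    Tendsto (rescaledTrace A) atTop (𝓝 (A.prod / 4)) := by
  have h1 := (tendsto_prod_latticeTheta hA).const_mul (A.prod / 4)
  have h2 : Tendsto (fun s : ℝ => π / (4 * s)) atTop (𝓝 0) :=
    (tendsto_id.const_mul_atTop four_pos).const_div_atTop π
  have h3 := h1.add (h2.mul (tendsto_exp_mul_sum_shiftedTheta le_rfl hA))
  rw [mul_one, mul_zero, add_zero] at h3
  exact h3.congr fun s => by simp [rescaledTrace]

lemma one_le_prod_latticeTheta {s : ℝ} (hs : 0 < s) {A : Multiset ℝ} (hA : ∀ a ∈ A, 0 < a) :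
    1 ≤ (A.map (latticeTheta s)).prod := by
  induction A using Multiset.induction_on with
  | empty => simp
  | cons a A ih =>
    rw [Multiset.map_cons, Multiset.prod_cons]
    exact one_le_mul_of_one_le_of_one_le
      (one_le_latticeTheta hs (hA a (Multiset.mem_cons_self a A)))
      (ih fun b hb => hA b (Multiset.mem_cons_of_mem hb))

lemma le_sum_shiftedTheta {s x : ℝ} (hs : 0 < s) {A : Multiset ℝ} (hA : ∀ a ∈ A, 0 < a)
    (hx : x ∈ A) : x * Real.exp (-(s * (x ^ 2 / 4))) ≤ (A.map (shiftedTheta s)).sum := by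
  refine (le_shiftedTheta hs (hA x hx)).trans
    (Multiset.single_le_sum (fun y hy => ?_) _ (Multiset.mem_map_of_mem _ hx))
  obtain ⟨a, ha, rfl⟩ := Multiset.mem_map.1 hy
  exact shiftedTheta_nonneg (hA a ha)

/-- If `x` occurs in `A` and is smaller than everything in `B`, then the term
`x exp (-s x²/4) / s` separates the traces of `M + A` and `M + B`. -/
lemma rescaledTrace_add_ne {M A B : Multiset ℝ} (hM : ∀ a ∈ M, 0 < a) (hA : ∀ a ∈ A, 0 < a)
    (hprod : (M + A).prod = (M + B).prod) {x : ℝ} (hx : x ∈ A) (hxB : ∀ b ∈ B, x < b) :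
    ¬ ∀ s, 0 < s → rescaledTrace (M + A) s = rescaledTrace (M + B) s := by
  intro heq
  have hx0 := hA x hx
  have hP : 0 < (M + A).prod := by
    refine Multiset.prod_pos fun a ha => ?_
    rcases Multiset.mem_add.1 ha with h | h
    exacts [hM a h, hA a h]
  have hlim := (((tendsto_prod_latticeTheta hM).const_mul (M + A).prod).mul
    (tendsto_exp_mul_prod_latticeTheta_sub_one hx0.le hxB)).add
    ((tendsto_exp_mul_sum_shiftedTheta hx0.le hxB).const_mul π)
  rw [mul_zero, mul_zero, add_zero] at hlim
  refine absurd (ge_of_tendsto hlim (b := π * x) ?_) (not_le.2 (by positivity))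
  filter_upwards [eventually_gt_atTop 0] with s hs
  have h := heq s hs
  rw [rescaledTrace, rescaledTrace, ← hprod] at h
  set P := (M + A).prod
  simp only [Multiset.map_add, Multiset.prod_add, Multiset.sum_add] at h
  have hΘM := one_le_prod_latticeTheta hs hM
  have hΘA := one_le_prod_latticeTheta hs hA
  have hHA := le_sum_shiftedTheta hs hA hx
  set ΘM := (M.map (latticeTheta s)).prod
  set ΘA := (A.map (latticeTheta s)).prod
  set ΘB := (B.map (latticeTheta s)).prod
  set HM := (M.map (shiftedTheta s)).sum
  set HA := (A.map (shiftedTheta s)).sum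
  set HB := (B.map (shiftedTheta s)).sum
  set E := Real.exp (s * (x ^ 2 / 4)) with hE
  have hE0 : 0 < E := Real.exp_pos _
  have hHA' : x ≤ E * HA := by
    rw [Real.exp_neg, ← hE, ← div_eq_mul_inv, div_le_iff₀ hE0] at hHA
    linarith
  have key : P * ΘM * (s * E * (ΘB - 1)) + π * (E * HB) =
      P * ΘM * (s * E * (ΘA - 1)) + π * (E * HA) := by
    field_simp at h
    linear_combination (-E) * h
  rw [key]
  have h1 : 0 ≤ P * ΘM * (s * E * (ΘA - 1)) := by
    have := sub_nonneg.2 hΘA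
    positivity
  nlinarith [Real.pi_pos]

/-- The rescaled trace determines the multiset of side lengths. -/
theorem eq_of_rescaledTrace_eq {A B : Multiset ℝ} (hA : ∀ a ∈ A, 0 < a) (hB : ∀ b ∈ B, 0 < b)
    (heq : ∀ s, 0 < s → rescaledTrace A s = rescaledTrace B s) : A = B := by
  have hprod : A.prod = B.prod := by
    have h := tendsto_nhds_unique (tendsto_rescaledTrace hA)
      ((tendsto_rescaledTrace hB).congr' (by
        filter_upwards [eventually_gt_atTop 0] with s hs using (heq s hs).symm))
    linarith
  have hA' : A ∩ B + (A - B) = A := by rw [add_comm, Multiset.sub_add_inter]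
  have hB' : A ∩ B + (B - A) = B := by rw [Multiset.inter_comm, add_comm, Multiset.sub_add_inter]
  have hdisj : ∀ x, x ∈ A - B → x ∉ B - A := fun x h1 h2 => by
    rw [Multiset.mem_sub] at h1 h2
    omega
  have hsubA : ∀ a ∈ A - B, 0 < a := fun a ha =>
    hA a (Multiset.mem_of_le (Multiset.sub_le_self _ _) ha)
  have hsubB : ∀ a ∈ B - A, 0 < a := fun a ha =>
    hB a (Multiset.mem_of_le (Multiset.sub_le_self _ _) ha)
  have hM : ∀ a ∈ A ∩ B, 0 < a := fun a ha => hA a (Multiset.mem_inter.1 ha).1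
  by_contra hne
  have hnonempty : ((A - B) + (B - A)).toFinset.Nonempty := by
    rw [Multiset.toFinset_nonempty]
    intro h0
    obtain ⟨h1, h2⟩ := add_eq_zero.1 h0
    exact hne (le_antisymm (tsub_eq_zero_iff_le.1 h1) (tsub_eq_zero_iff_le.1 h2))
  obtain ⟨x, hx, hmin⟩ := Finset.exists_min_image _ id hnonempty
  simp only [Multiset.mem_toFinset, Multiset.mem_add, id] at hx hmin
  rcases hx with hx | hx
  · refine rescaledTrace_add_ne (B := B - A) hM hsubA (by rw [hA', hB', hprod]) hx
      (fun b hb => (hmin b (Or.inr hb)).lt_of_ne ?_) (by rwa [hA', hB'])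
    rintro rfl
    exact hdisj _ hx hb
  · refine rescaledTrace_add_ne (B := A - B) hM hsubB (by rw [hA', hB', hprod]) hx
      (fun b hb => (hmin b (Or.inl hb)).lt_of_ne ?_)
      (by rw [hA', hB']; exact fun s hs => (heq s hs).symm)
    rintro rfl
    exact hdisj _ hb hx

lemma tsum_rectLattice {a₁ a₂ a₃ s : ℝ} (ha₁ : 0 < a₁) (ha₂ : 0 < a₂) (ha₃ : 0 < a₃)
    (hs : 0 < s) :
    ∑' v : rectLattice a₁ a₂ a₃, Real.exp (-s * ‖(v : EuclideanSpace ℝ (Fin 3))‖ ^ 2) =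
      latticeTheta s a₁ * (latticeTheta s a₂ * latticeTheta s a₃) := by
  let f : ℤ × ℤ × ℤ → EuclideanSpace ℝ (Fin 3) := fun m =>
    (WithLp.equiv 2 (Fin 3 → ℝ)).symm ![a₁ * m.1, a₂ * m.2.1, a₃ * m.2.2]
  have hf : Function.Injective f := by
    intro m n h
    have h' := (WithLp.equiv 2 (Fin 3 → ℝ)).symm.injective h
    have h0 := congrFun h' 0
    have h1 := congrFun h' 1
    have h2 := congrFun h' 2
    simp [ha₁.ne', ha₂.ne', ha₃.ne'] at h0 h1 h2
    exact Prod.ext h0 (Prod.ext h1 h2)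
  have hrange : rectLattice a₁ a₂ a₃ = Set.range f := by
    ext v
    exact exists_congr fun m => eq_comm
  rw [hrange, tsum_range (fun v => Real.exp (-s * ‖v‖ ^ 2)) hf]
  have hn : ∀ m : ℤ × ℤ × ℤ, Real.exp (-s * ‖f m‖ ^ 2) =
      Real.exp (-s * (a₁ * m.1) ^ 2) *
        (Real.exp (-s * (a₂ * m.2.1) ^ 2) * Real.exp (-s * (a₃ * m.2.2) ^ 2)) := fun m => by
    rw [EuclideanSpace.norm_sq_eq, Fin.sum_univ_three, ← Real.exp_add, ← Real.exp_add]
    congr 1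
    simp only [f, WithLp.equiv_symm_apply, Real.norm_eq_abs, sq_abs, Matrix.cons_val]
    ring
  simp only [hn]
  have h1 := summable_latticeTheta hs ha₁
  have h2 := summable_latticeTheta hs ha₂
  have h3 := summable_latticeTheta hs ha₃
  have h23 := h2.mul_of_nonneg h3 (fun _ => (Real.exp_pos _).le) fun _ => (Real.exp_pos _).le
  have h123 := h1.mul_of_nonneg h23 (fun _ => (Real.exp_pos _).le) fun _ => by positivity
  rw [latticeTheta, latticeTheta, latticeTheta, h2.tsum_mul_tsum h3 h23, h1.tsum_mul_tsum h23 h123]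

lemma rescaledTrace_eq_M6trace {a₁ a₂ a₃ s : ℝ} (ha₁ : 0 < a₁) (ha₂ : 0 < a₂) (ha₃ : 0 < a₃)
    (hs : 0 < s) :
    rescaledTrace {a₁, a₂, a₃} s = 8 * √(π / (4 * s)) ^ 3 * M6trace a₁ a₂ a₃ (1 / (4 * s)) := by
  have hr : 0 < π / (4 * s) := by positivity
  have hpow : (4 * π * (1 / (4 * s))) ^ ((3 : ℝ) / 2) = 8 * √(π / (4 * s)) ^ 3 := by
    have h4 : 4 * π * (1 / (4 * s)) = (2 * √(π / (4 * s))) ^ 2 := by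
      rw [mul_pow, Real.sq_sqrt hr.le]
      field_simp
      norm_num
    rw [h4, ← Real.rpow_natCast, ← Real.rpow_mul (by positivity)]
    norm_num
    rw [mul_pow]
    norm_num
  have hlat : ∀ r : ℝ, -r / (4 * (1 / (4 * s))) = -s * r := fun r => by field_simp
  have hshift : ∀ (a : ℝ) (m : ℤ), -((m : ℝ) + 1 / 2) ^ 2 * a ^ 2 / (4 * (1 / (4 * s))) =
      -s * (a * (m + 1 / 2)) ^ 2 := fun a m => by field_simp
  have hsq := Real.sq_sqrt hr.le
  have hpos := Real.sqrt_pos.2 hr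
  have hmul : π * (1 / (4 * s)) = π / (4 * s) := by ring
  simp only [M6trace, hpow, hlat, hshift, tsum_rectLattice ha₁ ha₂ ha₃ hs, hmul]
  simp only [rescaledTrace, Multiset.insert_eq_cons, Multiset.map_cons, Multiset.prod_cons,
    Multiset.map_singleton, Multiset.prod_singleton, Multiset.sum_cons, Multiset.sum_singleton,
    shiftedTheta]
  set r := √(π / (4 * s))
  rw [← hsq]
  generalize ∑' m : ℤ, Real.exp (-s * (a₁ * (m + 1 / 2)) ^ 2) = h₁
  generalize ∑' m : ℤ, Real.exp (-s * (a₂ * (m + 1 / 2)) ^ 2) = h₂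
  generalize ∑' m : ℤ, Real.exp (-s * (a₃ * (m + 1 / 2)) ^ 2) = h₃
  field_simp
  ring

/-- Case `M₆` of Theorem B: two flat 3-manifolds of type `M₆` with equal trace functions
have the same unordered triple of side lengths. -/
theorem M6_isospectral_implies_isometric
    (a₁ a₂ a₃ b₁ b₂ b₃ : ℝ)
    (ha₁ : 0 < a₁) (ha₂ : 0 < a₂) (ha₃ : 0 < a₃)
    (hb₁ : 0 < b₁) (hb₂ : 0 < b₂) (hb₃ : 0 < b₃)
    (heq : ∀ t : ℝ, 0 < t → M6trace a₁ a₂ a₃ t = M6trace b₁ b₂ b₃ t) :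
    ({a₁, a₂, a₃} : Multiset ℝ) = ({b₁, b₂, b₃} : Multiset ℝ) := by
  refine eq_of_rescaledTrace_eq (by simp [ha₁, ha₂, ha₃]) (by simp [hb₁, hb₂, hb₃]) fun s hs => ?_
  rw [rescaledTrace_eq_M6trace ha₁ ha₂ ha₃ hs, rescaledTrace_eq_M6trace hb₁ hb₂ hb₃ hs,
    heq _ (by positivity)]
end
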